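/- Let n ≥ 3 be an integer, let n₀ = max{⌈(n²−n−2)/2⌉, n}, and define α₀ = 2⌈n₀/2⌉ and α_i = (n−1)·R(n, α_{i−1}+1) − 1 for i ≥ 1, where R denotes the Ramsey number. Then every weakly connected digraph D satisfying (D'1), (D2) and (D3) satisfies pp(D) ≤ Σ_{i=1}^{2n₀−1} α_i + n(2n−1)(n−1) + (n+1)·(n(n+5)/2 + 1). -/

import Mathlib

/-! ## Basic notions for graphs and digraphs

A digraph on a vertex type `V` is given by its arc relation `E : V → V → Prop`.
Simplicity and absence of 2-cycles is expressed by the hypothesis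
`∀ u v, E u v → ¬ E v u`.  The underlying graph `G_D` is `SimpleGraph.fromRel E`. -/

/-- `G` contains an induced copy of the simple graph `H`. -/
def HasInducedCopyG {W V : Type} (H : SimpleGraph W) (G : SimpleGraph V) : Prop :=
  ∃ f : W → V, Function.Injective f ∧ ∀ a b : W, G.Adj (f a) (f b) ↔ H.Adj a b

/-- The digraph `E` contains an induced copy of the digraph `H`. -/
def DigraphHasInducedCopy {W V : Type} (H : W → W → Prop) (E : V → V → Prop) : Prop :=
  ∃ f : W → V, Function.Injective f ∧ ∀ a b : W, E (f a) (f b) ↔ H a b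

/-- The star `K_{1,n}` with one center and `n` leaves. -/
def StarG (n : ℕ) : SimpleGraph (Unit ⊕ Fin n) :=
  SimpleGraph.fromRel (fun a b =>
    match a, b with
    | Sum.inl _, Sum.inr _ => True
    | _, _ => False)

/-- The path `P_n` of order `n`. -/
def PathG (n : ℕ) : SimpleGraph (Fin n) :=
  SimpleGraph.fromRel (fun i j => i.val + 1 = j.val)

/-- The graph `K*_n`: a complete graph on the `x_i` together with pendant edges `x_i y_i`. -/
def KStarG (n : ℕ) : SimpleGraph (Fin n ⊕ Fin n) :=
  SimpleGraph.fromRel (fun a b =>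
    match a, b with
    | Sum.inl i, Sum.inl j => i ≠ j
    | Sum.inl i, Sum.inr j => i = j
    | _, _ => False)

/-- The graph `F^(1)_n` on `{x₁,x₂} ∪ {yᵢ} ∪ {zᵢ}`:
edges `x₁x₂, x₁y₁, x₁z₁` together with the two paths `y₁⋯y_n` and `z₁⋯z_n`. -/
def F1G (n : ℕ) : SimpleGraph (Fin 2 ⊕ Fin n ⊕ Fin n) :=
  SimpleGraph.fromRel (fun a b =>
    match a, b with
    | Sum.inl i, Sum.inl j => i.val = 0 ∧ j.val = 1
    | Sum.inl i, Sum.inr (Sum.inl j) => i.val = 0 ∧ j.val = 0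
    | Sum.inl i, Sum.inr (Sum.inr j) => i.val = 0 ∧ j.val = 0
    | Sum.inr (Sum.inl i), Sum.inr (Sum.inl j) => i.val + 1 = j.val
    | Sum.inr (Sum.inr i), Sum.inr (Sum.inr j) => i.val + 1 = j.val
    | _, _ => False)

/-- The single edge `y₁z₁` (used to build `F^(2)_n` and `F^(4)_n`). -/
def YZEdgeG (n : ℕ) : SimpleGraph (Fin 2 ⊕ Fin n ⊕ Fin n) :=
  SimpleGraph.fromRel (fun a b =>
    match a, b with
    | Sum.inr (Sum.inl i), Sum.inr (Sum.inr j) => i.val = 0 ∧ j.val = 0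
    | _, _ => False)

/-- `F^(2)_n = F^(1)_n + y₁z₁`. -/
def F2G (n : ℕ) : SimpleGraph (Fin 2 ⊕ Fin n ⊕ Fin n) := F1G n ⊔ YZEdgeG n

/-- The graph `F^(3)_n`: edges `x₁y₁, x₁z₁, x₂y₁, x₂z₁` together with the two paths. -/
def F3G (n : ℕ) : SimpleGraph (Fin 2 ⊕ Fin n ⊕ Fin n) :=
  SimpleGraph.fromRel (fun a b =>
    match a, b with
    | Sum.inl _, Sum.inr (Sum.inl j) => j.val = 0
    | Sum.inl _, Sum.inr (Sum.inr j) => j.val = 0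
    | Sum.inr (Sum.inl i), Sum.inr (Sum.inl j) => i.val + 1 = j.val
    | Sum.inr (Sum.inr i), Sum.inr (Sum.inr j) => i.val + 1 = j.val
    | _, _ => False)

/-- `F^(4)_n = F^(3)_n + y₁z₁`. -/
def F4G (n : ℕ) : SimpleGraph (Fin 2 ⊕ Fin n ⊕ Fin n) := F3G n ⊔ YZEdgeG n

/-- The digraph `D^(1)_n` on `{x₁} ∪ {yᵢ} ∪ {zᵢ}` with arcs
`(x₁,y₁), (z₁,x₁), (y₁,z₁)`, `(y_{i+1}, y_i)` and `(z_i, z_{i+1})`. -/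
def D1Rel (n : ℕ) : (Unit ⊕ Fin n ⊕ Fin n) → (Unit ⊕ Fin n ⊕ Fin n) → Prop := fun a b =>
  match a, b with
  | Sum.inl _, Sum.inr (Sum.inl j) => j.val = 0
  | Sum.inr (Sum.inr i), Sum.inl _ => i.val = 0
  | Sum.inr (Sum.inl i), Sum.inr (Sum.inr j) => i.val = 0 ∧ j.val = 0
  | Sum.inr (Sum.inl i), Sum.inr (Sum.inl j) => j.val + 1 = i.val
  | Sum.inr (Sum.inr i), Sum.inr (Sum.inr j) => i.val + 1 = j.val
  | _, _ => False

/-- `D^(2)_n`: obtained from `D^(1)_n` by replacing the arc `(z₁,x₁)` by `(x₁,z₁)`. -/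
def D2Rel (n : ℕ) : (Unit ⊕ Fin n ⊕ Fin n) → (Unit ⊕ Fin n ⊕ Fin n) → Prop := fun a b =>
  match a, b with
  | Sum.inl _, Sum.inr (Sum.inl j) => j.val = 0
  | Sum.inl _, Sum.inr (Sum.inr j) => j.val = 0
  | Sum.inr (Sum.inl i), Sum.inr (Sum.inr j) => i.val = 0 ∧ j.val = 0
  | Sum.inr (Sum.inl i), Sum.inr (Sum.inl j) => j.val + 1 = i.val
  | Sum.inr (Sum.inr i), Sum.inr (Sum.inr j) => i.val + 1 = j.val
  | _, _ => False

/-- `D^(3)_n`: obtained from `D^(1)_n` by replacing the arc `(x₁,y₁)` by `(y₁,x₁)`. -/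
def D3Rel (n : ℕ) : (Unit ⊕ Fin n ⊕ Fin n) → (Unit ⊕ Fin n ⊕ Fin n) → Prop := fun a b =>
  match a, b with
  | Sum.inr (Sum.inl i), Sum.inl _ => i.val = 0
  | Sum.inr (Sum.inr i), Sum.inl _ => i.val = 0
  | Sum.inr (Sum.inl i), Sum.inr (Sum.inr j) => i.val = 0 ∧ j.val = 0
  | Sum.inr (Sum.inl i), Sum.inr (Sum.inl j) => j.val + 1 = i.val
  | Sum.inr (Sum.inr i), Sum.inr (Sum.inr j) => i.val + 1 = j.val
  | _, _ => False

/-- The transitive tournament `T_n`. -/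
def TRel (n : ℕ) : Fin n → Fin n → Prop := fun i j => i < j

/-- A (nonempty) directed path in the digraph `E`, recorded as its list of vertices. -/
def IsDirPathList {V : Type} (E : V → V → Prop) (l : List V) : Prop :=
  l ≠ [] ∧ l.Nodup ∧ l.Chain' E

/-- The path cover number of the subdigraph of `E` induced by `X`:
the minimum number of directed paths of `E[X]` whose vertex sets cover `X`. -/
noncomputable def pcOn {V : Type} (E : V → V → Prop) (X : Set V) : ℕ :=
  sInf {k | ∃ P : Finset (List V), P.card = k ∧
    (∀ l ∈ P, IsDirPathList E l ∧ ∀ v ∈ l, v ∈ X) ∧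
    ∀ v ∈ X, ∃ l ∈ P, v ∈ l}

/-- The path partition number of the subdigraph of `E` induced by `X`:
the minimum number of pairwise vertex-disjoint directed paths of `E[X]`
whose vertex sets partition `X`. -/
noncomputable def ppOn {V : Type} (E : V → V → Prop) (X : Set V) : ℕ :=
  sInf {k | ∃ P : Finset (List V), P.card = k ∧
    (∀ l ∈ P, IsDirPathList E l ∧ ∀ v ∈ l, v ∈ X) ∧
    (∀ v ∈ X, ∃ l ∈ P, v ∈ l) ∧
    ∀ l ∈ P, ∀ l' ∈ P, l ≠ l' → ∀ v ∈ l, v ∉ l'}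

/-- A (nonempty) path in the simple graph `G`, recorded as its list of vertices. -/
def IsPathList {V : Type} (G : SimpleGraph V) (l : List V) : Prop :=
  l ≠ [] ∧ l.Nodup ∧ l.Chain' G.Adj

/-- The path cover number `pc(G)` of a simple graph `G`. -/
noncomputable def pcG {V : Type} (G : SimpleGraph V) : ℕ :=
  sInf {k | ∃ P : Finset (List V), P.card = k ∧
    (∀ l ∈ P, IsPathList G l) ∧ ∀ v : V, ∃ l ∈ P, v ∈ l}

/-- The path partition number `pp(G)` of a simple graph `G`. -/
noncomputable def ppG {V : Type} (G : SimpleGraph V) : ℕ :=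
  sInf {k | ∃ P : Finset (List V), P.card = k ∧
    (∀ l ∈ P, IsPathList G l) ∧ (∀ v : V, ∃ l ∈ P, v ∈ l) ∧
    ∀ l ∈ P, ∀ l' ∈ P, l ≠ l' → ∀ v ∈ l, v ∉ l'}

/-- A directed cycle in the digraph `E`, recorded as its list of vertices. -/
def IsDirCycleList {V : Type} (E : V → V → Prop) (l : List V) : Prop :=
  ∃ h : l ≠ [], 3 ≤ l.length ∧ l.Nodup ∧ l.Chain' E ∧ E (l.getLast h) (l.head h)

/-- A member of a cycle cover/partition: a directed cycle, or a weakly connected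
subdigraph of order at most two. -/
def IsCyclePartMember {V : Type} (E : V → V → Prop) (l : List V) : Prop :=
  IsDirCycleList E l ∨
    (l ≠ [] ∧ l.length ≤ 2 ∧ l.Nodup ∧ l.Chain' (fun a b => E a b ∨ E b a))

/-- The cycle partition number `cp(D)` of the digraph `E`. -/
noncomputable def cpNum {V : Type} (E : V → V → Prop) : ℕ :=
  sInf {k | ∃ P : Finset (List V), P.card = k ∧
    (∀ l ∈ P, IsCyclePartMember E l) ∧
    (∀ v : V, ∃ l ∈ P, v ∈ l) ∧
    ∀ l ∈ P, ∀ l' ∈ P, l ≠ l' → ∀ v ∈ l, v ∉ l'}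

/-- `v : Fin m → V` enumerates an induced path of the simple graph `G`. -/
def IsInducedPathEmb {V : Type} (G : SimpleGraph V) {m : ℕ} (v : Fin m → V) : Prop :=
  Function.Injective v ∧
    ∀ i j : Fin m, G.Adj (v i) (v j) ↔ (i.val + 1 = j.val ∨ j.val + 1 = i.val)

/-- `w : Fin m → V` enumerates an induced pseudo-path of the digraph `E`:
the induced subdigraph on its image has a path as underlying graph. -/
def IsInducedPsPath {V : Type} (E : V → V → Prop) {m : ℕ} (w : Fin m → V) : Prop :=
  Function.Injective w ∧
    ∀ i j : Fin m, (E (w i) (w j) ∨ E (w j) (w i)) ↔ (i.val + 1 = j.val ∨ j.val + 1 = i.val)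

/-- `r(P)` for a pseudo-path enumerated by `w`: the number of (internal) vertices
having out-degree 2 or in-degree 2 in the pseudo-path. -/
noncomputable def turnCount {V : Type} (E : V → V → Prop) {m : ℕ} (w : Fin m → V) : ℕ :=
  Set.ncard {i : Fin m | ∃ j k : Fin m, j.val + 1 = i.val ∧ i.val + 1 = k.val ∧
    ((E (w i) (w j) ∧ E (w i) (w k)) ∨ (E (w j) (w i) ∧ E (w k) (w i)))}

/-- Condition (D1): the underlying graph of `E` is `{K*_n, K_{1,n}, F^(1)_n, F^(2)_n}`-free. -/
def CondD1 {V : Type} (n : ℕ) (E : V → V → Prop) : Prop :=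
  ¬ HasInducedCopyG (KStarG n) (SimpleGraph.fromRel E) ∧
  ¬ HasInducedCopyG (StarG n) (SimpleGraph.fromRel E) ∧
  ¬ HasInducedCopyG (F1G n) (SimpleGraph.fromRel E) ∧
  ¬ HasInducedCopyG (F2G n) (SimpleGraph.fromRel E)

/-- Condition (D'1): the underlying graph of `E` is
`{K*_n, K_{1,n}, F^(1)_n, F^(2)_n, F^(3)_n, F^(4)_n}`-free. -/
def CondD1' {V : Type} (n : ℕ) (E : V → V → Prop) : Prop :=
  CondD1 n E ∧
  ¬ HasInducedCopyG (F3G n) (SimpleGraph.fromRel E) ∧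
  ¬ HasInducedCopyG (F4G n) (SimpleGraph.fromRel E)

/-- Condition (D2): `E` is `{D^(1)_n, D^(2)_n, D^(3)_n}`-free. -/
def CondD2 {V : Type} (n : ℕ) (E : V → V → Prop) : Prop :=
  ¬ DigraphHasInducedCopy (D1Rel n) E ∧
  ¬ DigraphHasInducedCopy (D2Rel n) E ∧
  ¬ DigraphHasInducedCopy (D3Rel n) E

/-- Condition (D3): `r(P) ≤ n` for every induced pseudo-path `P` of `E`. -/
def CondD3 {V : Type} (n : ℕ) (E : V → V → Prop) : Prop :=
  ∀ (m : ℕ) (w : Fin m → V), IsInducedPsPath E w → turnCount E w ≤ n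

/-- The Ramsey number `R(a, b)`: the least `R` such that every graph on at least `R`
vertices contains a clique of size `a` or an independent set of size `b`. -/
noncomputable def ramseyNumber (a b : ℕ) : ℕ :=
  sInf {R | ∀ m : ℕ, R ≤ m → ∀ G : SimpleGraph (Fin m),
    (∃ s : Finset (Fin m), G.IsNClique a s) ∨ (∃ s : Finset (Fin m), Gᶜ.IsNClique b s)}

/-- The independence number of the subgraph of `G` induced by `X`. -/
noncomputable def indepNumOn {V : Type} (G : SimpleGraph V) (X : Set V) : ℕ :=
  sSup {k | ∃ s : Finset V, ↑s ⊆ X ∧ s.card = k ∧ ∀ a ∈ s, ∀ b ∈ s, a ≠ b → ¬ G.Adj a b}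

/-- The independence number `α(G)`. -/
noncomputable def indepNum {V : Type} (G : SimpleGraph V) : ℕ := indepNumOn G Set.univ

/-- The neighborhood `N_G(X)` of a set of vertices. -/
def nbhd {V : Type} (G : SimpleGraph V) (X : Set V) : Set V :=
  {v | v ∉ X ∧ ∃ x ∈ X, G.Adj v x}
/-! ## Path partitions built one head at a time -/

/-- `PathPart E X H`: the induced subdigraph on `X` has a partition into directed paths whose
set of initial vertices is `H`. -/
inductive PathPart {V : Type} [DecidableEq V] (E : V → V → Prop) : Finset V → Finset V → Prop
  | empty : PathPart E ∅ ∅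
  | single {X H : Finset V} (u : V) : u ∉ X → PathPart E X H →
      PathPart E (insert u X) (insert u H)
  | cons {X H : Finset V} (u v : V) : u ∉ X → v ∈ H → E u v → PathPart E X H →
      PathPart E (insert u X) (insert u (H.erase v))

namespace PathPart

variable {V : Type} [DecidableEq V] {E : V → V → Prop}

theorem subset {X H : Finset V} (h : PathPart E X H) : H ⊆ X := by
  induction h with
  | empty => simp
  | single u hu _ ih => exact Finset.insert_subset_insert _ ih
  | cons u v hu hv he _ ih =>
    exact Finset.insert_subset_insert _ ((Finset.erase_subset _ _).trans ih)

theorem refl (X : Finset V) : PathPart E X X := by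
  induction X using Finset.induction_on with
  | empty => exact .empty
  | insert u X hu ih => exact .single u hu ih

theorem union {X H Y K : Finset V} (h : PathPart E X H) (h' : PathPart E Y K)
    (hd : Disjoint X Y) : PathPart E (X ∪ Y) (H ∪ K) := by
  induction h with
  | empty => simpa using h'
  | @single X H u hu _ ih =>
    rw [Finset.disjoint_insert_left] at hd
    rw [Finset.insert_union, Finset.insert_union]
    exact .single u (by simp [hu, hd.1]) (ih hd.2)
  | @cons X H u v hu hv he h0 ih =>
    rw [Finset.disjoint_insert_left] at hd
    have hvK : v ∉ K := fun hk =>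
      Finset.disjoint_left.1 hd.2 (h0.subset hv) (h'.subset hk)
    rw [Finset.insert_union, Finset.insert_union]
    have := PathPart.cons (E := E) u v (X := X ∪ Y) (H := H ∪ K)
      (by simp [hu, hd.1]) (by simp [hv]) he (ih hd.2)
    rwa [Finset.erase_union_distrib, Finset.erase_eq_of_notMem hvK] at this

theorem erase_head {X H : Finset V} (h : PathPart E X H) {u : V} (hu : u ∈ H) :
    PathPart E (X.erase u) (H.erase u) ∨
      ∃ u', E u u' ∧ u' ∉ H ∧ PathPart E (X.erase u) (insert u' (H.erase u)) := by
  induction h with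
  | empty => simp at hu
  | @single X H w hw h0 ih =>
    by_cases huw : u = w
    · subst huw
      left
      rw [Finset.erase_insert hw, Finset.erase_insert (fun h => hw (h0.subset h))]
      exact h0
    · have huH : u ∈ H := by simpa [huw] using hu
      have e1 : (insert w X).erase u = insert w (X.erase u) :=
        Finset.erase_insert_of_ne (Ne.symm huw)
      have e2 : (insert w H).erase u = insert w (H.erase u) :=
        Finset.erase_insert_of_ne (Ne.symm huw)
      rw [e1, e2]
      have hw' : w ∉ X.erase u := by simp [hw]
      rcases ih huH with h | ⟨u', he, hn, h⟩
      · exact Or.inl (.single w hw' h)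
      · refine Or.inr ⟨u', he, ?_, ?_⟩
        · have : u' ∈ X.erase u := h.subset (by simp)
          have : u' ≠ w := by rintro rfl; exact hw (Finset.mem_of_mem_erase this)
          simp [this, hn]
        · rw [Finset.insert_comm]
          exact .single w hw' h
  | @cons X H w v hw hv he0 h0 ih =>
    by_cases huw : u = w
    · subst huw
      right
      have huH : u ∉ H := fun h => hw (h0.subset h)
      refine ⟨v, he0, ?_, ?_⟩
      · have : v ≠ u := by rintro rfl; exact huH hv
        simp [this]
      · rw [Finset.erase_insert hw, Finset.erase_insert (by simp [huH]), Finset.insert_erase hv]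
        exact h0
    · have huH : u ∈ H ∧ u ≠ v := by
        have := hu
        simp [huw] at this
        exact ⟨this.2, this.1⟩
      have e1 : (insert w X).erase u = insert w (X.erase u) :=
        Finset.erase_insert_of_ne (Ne.symm huw)
      have e2 : (insert w (H.erase v)).erase u = insert w ((H.erase u).erase v) := by
        rw [Finset.erase_insert_of_ne (Ne.symm huw), Finset.erase_right_comm]
      rw [e1, e2]
      have hw' : w ∉ X.erase u := by simp [hw]
      have hv' : v ∈ H.erase u := by simp [hv, Ne.symm huH.2]
      rcases ih huH.1 with h | ⟨u', he, hn, h⟩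
      · exact Or.inl (.cons w v hw' hv' he0 h)
      · refine Or.inr ⟨u', he, ?_, ?_⟩
        · have : u' ∈ X.erase u := h.subset (by simp)
          have : u' ≠ w := by rintro rfl; exact hw (Finset.mem_of_mem_erase this)
          simp [this, hn]
        · have hne : u' ≠ v := by rintro rfl; exact hn hv
          rw [Finset.insert_comm, ← Finset.erase_insert_of_ne hne]
          exact .cons w v hw' (by simp [hv']) he0 h

theorem exists_lists {X H : Finset V} (h : PathPart E X H) :
    ∃ P : Finset (List V), P.card ≤ H.card ∧
      (∀ l ∈ P, IsDirPathList E l ∧ ∀ v ∈ l, v ∈ X) ∧ (∀ v ∈ X, ∃ l ∈ P, v ∈ l) ∧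
      (∀ l ∈ P, ∀ l' ∈ P, l ≠ l' → ∀ v ∈ l, v ∉ l') ∧ ∀ v ∈ H, ∃ l, v :: l ∈ P := by
  induction h with
  | empty => exact ⟨∅, by simp⟩
  | @single X H u hu h0 ih =>
    obtain ⟨P, hc, hp, hcov, hdis, hhd⟩ := ih
    have huP : ∀ l ∈ P, u ∉ l := fun l hl h => hu ((hp l hl).2 u h)
    refine ⟨insert [u] P, ?_, ?_, ?_, ?_, ?_⟩
    · rw [Finset.card_insert_of_notMem (fun h => hu (h0.subset h))]
      exact (Finset.card_insert_le _ _).trans (by omega)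
    · intro l hl
      rcases Finset.mem_insert.1 hl with rfl | hl
      · refine ⟨⟨by simp, by simp, List.isChain_singleton _⟩, by simp⟩
      · exact ⟨(hp l hl).1, fun v hv => Finset.mem_insert_of_mem ((hp l hl).2 v hv)⟩
    · intro v hv
      rcases Finset.mem_insert.1 hv with rfl | hv
      · exact ⟨[v], by simp, by simp⟩
      · obtain ⟨l, hl, hvl⟩ := hcov v hv
        exact ⟨l, by simp [hl], hvl⟩
    · intro l hl l' hl' hne v hv hv'
      rcases Finset.mem_insert.1 hl with rfl | hl <;> rcases Finset.mem_insert.1 hl' with rfl | hl'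
      · exact hne rfl
      · rw [List.mem_singleton.1 hv] at hv'
        exact huP l' hl' hv'
      · rw [List.mem_singleton.1 hv'] at hv
        exact huP l hl hv
      · exact hdis l hl l' hl' hne v hv hv'
    · intro v hv
      rcases Finset.mem_insert.1 hv with rfl | hv
      · exact ⟨[], by simp⟩
      · obtain ⟨l, hl⟩ := hhd v hv
        exact ⟨l, by simp [hl]⟩
  | @cons X H u v hu hv he h0 ih =>
    obtain ⟨P, hc, hp, hcov, hdis, hhd⟩ := ih
    have huP : ∀ l ∈ P, u ∉ l := fun l hl h => hu ((hp l hl).2 u h)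
    obtain ⟨t, ht⟩ := hhd v hv
    have hpt := hp _ ht
    refine ⟨insert (u :: v :: t) (P.erase (v :: t)), ?_, ?_, ?_, ?_, ?_⟩
    · have : u ∉ H.erase v := fun h => hu (h0.subset (Finset.mem_of_mem_erase h))
      rw [Finset.card_insert_of_notMem this, Finset.card_erase_of_mem hv]
      refine (Finset.card_insert_le _ _).trans ?_
      rw [Finset.card_erase_of_mem ht]
      omega
    · intro l hl
      rcases Finset.mem_insert.1 hl with rfl | hl
      · refine ⟨⟨by simp, List.nodup_cons.2 ⟨huP _ ht, hpt.1.2.1⟩,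
          List.isChain_cons_cons.2 ⟨he, hpt.1.2.2⟩⟩, ?_⟩
        intro w hw
        rcases List.mem_cons.1 hw with rfl | hw
        · simp
        · exact Finset.mem_insert_of_mem (hpt.2 w hw)
      · have hl := Finset.mem_of_mem_erase hl
        exact ⟨(hp l hl).1, fun v hv => Finset.mem_insert_of_mem ((hp l hl).2 v hv)⟩
    · intro w hw
      rcases Finset.mem_insert.1 hw with rfl | hw
      · exact ⟨_, Finset.mem_insert_self _ _, by simp⟩
      · obtain ⟨l, hl, hvl⟩ := hcov w hw
        by_cases hlt : l = v :: t
        · subst hlt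
          exact ⟨_, Finset.mem_insert_self _ _, List.mem_cons_of_mem _ hvl⟩
        · exact ⟨l, by simp [hl, hlt], hvl⟩
    · have key : ∀ l ∈ P.erase (v :: t), ∀ w ∈ l, w ∉ u :: v :: t := by
        intro l hl w hw hw'
        have hl' := Finset.mem_of_mem_erase hl
        rcases List.mem_cons.1 hw' with rfl | hw'
        · exact huP l hl' hw
        · exact hdis l hl' _ ht (Finset.ne_of_mem_erase hl) w hw hw'
      intro l hl l' hl' hne w hw hw'
      rcases Finset.mem_insert.1 hl with rfl | hl <;> rcases Finset.mem_insert.1 hl' with rfl | hl'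
      · exact hne rfl
      · exact key _ hl' _ hw' hw
      · exact key _ hl _ hw hw'
      · exact hdis l (Finset.mem_of_mem_erase hl) l' (Finset.mem_of_mem_erase hl') hne w hw hw'
    · intro w hw
      rcases Finset.mem_insert.1 hw with rfl | hw
      · exact ⟨v :: t, by simp⟩
      · obtain ⟨l, hl⟩ := hhd w (Finset.mem_of_mem_erase hw)
        have : w ≠ v := Finset.ne_of_mem_erase hw
        exact ⟨l, by simp [hl, this]⟩

/-- A path partition with more paths than any independent set can be improved. -/
theorem exists_ssubset {X H : Finset V} (h : PathPart E X H)
    (hind : ∀ I ⊆ X, (∀ u ∈ I, ∀ v ∈ I, ¬ E u v) → I.card < H.card) (hirr : ∀ u, ¬ E u u) :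
    ∃ H', H' ⊂ H ∧ PathPart E X H' := by
  induction hN : X.card generalizing X H with
  | zero =>
    obtain rfl := Finset.card_eq_zero.1 hN
    have := hind ∅ (by simp) (by simp)
    have h0 := Finset.card_le_card h.subset
    simp at this h0
    simp [h0] at this
  | succ N ih =>
    have hH : ∃ u ∈ H, ∃ v ∈ H, E u v := by
      by_contra hcon
      push Not at hcon
      exact lt_irrefl _ (hind H h.subset hcon)
    obtain ⟨u, hu, v, hv, he⟩ := hH
    have huv : v ≠ u := by rintro rfl; exact hirr _ he
    have huX : u ∈ X := h.subset hu
    have hvu : v ∈ H.erase u := by simp [hv, huv]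
    have hnew : ∀ {K}, u ∈ K → v ∉ K → K ⊆ H → PathPart E X K → ∃ H', H' ⊂ H ∧ PathPart E X H' :=
      fun _ hvK hK hp => ⟨_, Finset.ssubset_iff_subset_ne.2 ⟨hK, by rintro rfl; exact hvK hv⟩, hp⟩
    have hext : ∀ {K} w, w ∈ K → E u w → PathPart E (X.erase u) K →
        PathPart E X (insert u (K.erase w)) := by
      intro K w hw he hp
      have := PathPart.cons u w (by simp) hw he hp
      rwa [Finset.insert_erase huX] at this
    rcases h.erase_head hu with h' | ⟨u', he', hu', h'⟩
    · refine hnew (Finset.mem_insert_self _ _) ?_ ?_ (hext v hvu he h')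
      · simp [huv]
      · intro x
        simp only [Finset.mem_insert, Finset.mem_erase]
        rintro (rfl | ⟨_, _, h⟩) <;> assumption
    · have hcard : (insert u' (H.erase u)).card = H.card := by
        rw [Finset.card_insert_of_notMem (by simp [hu']), Finset.card_erase_add_one hu]
      obtain ⟨H', hss, hp⟩ := ih h' (fun I hI hI' => by
        rw [hcard]; exact hind I (hI.trans (Finset.erase_subset _ _)) hI')
        (by rw [Finset.card_erase_of_mem huX]; omega)
      have hsub := hss.1
      by_cases hu'H : u' ∈ H'
      · refine ⟨_, ?_, hext u' hu'H he' hp⟩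
        refine Finset.ssubset_iff_subset_ne.2 ⟨?_, ?_⟩
        · intro x hx
          simp only [Finset.mem_insert, Finset.mem_erase] at hx
          rcases hx with rfl | ⟨hxu, hx⟩
          · exact hu
          · have := hsub hx
            simp [hxu] at this
            exact this.2
        · intro heq
          apply hss.2
          intro x hx
          rcases Finset.mem_insert.1 hx with rfl | hx
          · exact hu'H
          · have h1 := Finset.mem_of_mem_erase hx
            rw [← heq] at h1
            simp [Finset.ne_of_mem_erase hx] at h1
            exact h1.2
      · have hsub' : H' ⊆ H.erase u := by
          intro x hx
          have := hsub hx
          rcases Finset.mem_insert.1 this with rfl | h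
          · exact absurd hx hu'H
          · exact h
        by_cases hvH : v ∈ H'
        · refine hnew (Finset.mem_insert_self _ _) ?_ ?_ (hext v hvH he hp)
          · simp [huv]
          · refine Finset.insert_subset hu ?_
            exact (Finset.erase_subset _ _).trans (hsub'.trans (Finset.erase_subset _ _))
        · have := PathPart.single u (by simp) hp
          rw [Finset.insert_erase huX] at this
          refine hnew (Finset.mem_insert_self _ _) ?_ ?_ this
          · simp [huv, hvH]
          · exact Finset.insert_subset hu (hsub'.trans (Finset.erase_subset _ _))

end PathPart

/-- The induced subdigraph on `X` has a path partition with at most `k` paths. -/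
def HasPathPart {V : Type} [DecidableEq V] (E : V → V → Prop) (X : Finset V) (k : ℕ) : Prop :=
  ∃ H, PathPart E X H ∧ H.card ≤ k

namespace HasPathPart

variable {V : Type} [DecidableEq V] {E : V → V → Prop}

theorem empty : HasPathPart E ∅ 0 := ⟨∅, .empty, by simp⟩

theorem mono {X : Finset V} {k k' : ℕ} (h : HasPathPart E X k) (hk : k ≤ k') :
    HasPathPart E X k' := by
  obtain ⟨H, h, hc⟩ := h
  exact ⟨H, h, hc.trans hk⟩

theorem union {X Y : Finset V} {k k' : ℕ} (h : HasPathPart E X k) (h' : HasPathPart E Y k')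
    (hd : Disjoint X Y) : HasPathPart E (X ∪ Y) (k + k') := by
  obtain ⟨H, h, hc⟩ := h
  obtain ⟨K, h', hc'⟩ := h'
  exact ⟨H ∪ K, h.union h' hd, (Finset.card_union_le _ _).trans (by omega)⟩

theorem biUnion_range {X : ℕ → Finset V} {k : ℕ → ℕ} (m : ℕ)
    (h : ∀ i < m, HasPathPart E (X i) (k i))
    (hd : ∀ i < m, ∀ j < m, i ≠ j → Disjoint (X i) (X j)) :
    HasPathPart E ((Finset.range m).biUnion X) (∑ i ∈ Finset.range m, k i) := by
  induction m with
  | zero => simpa using empty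
  | succ m ih =>
    rw [Finset.sum_range_succ, Finset.range_add_one, Finset.biUnion_insert, Finset.union_comm]
    refine (ih (fun i hi => h i (by omega)) (fun i hi j hj => hd i (by omega) j (by omega))).union
      (h m (by omega)) ?_
    rw [Finset.disjoint_biUnion_left]
    intro i hi
    have := Finset.mem_range.1 hi
    exact hd i (by omega) m (by omega) (by omega)

/-- The Gallai–Milgram theorem. -/
theorem of_indep {X : Finset V} {k : ℕ} (hirr : ∀ u, ¬ E u u)
    (hind : ∀ I ⊆ X, (∀ u ∈ I, ∀ v ∈ I, ¬ E u v) → I.card ≤ k) : HasPathPart E X k := by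
  have key : ∀ N, ∀ H, H.card ≤ N → PathPart E X H → HasPathPart E X k := by
    intro N
    induction N with
    | zero => exact fun H hH h => ⟨H, h, by omega⟩
    | succ N ih =>
      intro H hH h
      by_cases hk : H.card ≤ k
      · exact ⟨H, h, hk⟩
      · obtain ⟨H', hss, h'⟩ := h.exists_ssubset
          (fun I hI hI' => lt_of_le_of_lt (hind I hI hI') (by omega)) hirr
        have := Finset.card_lt_card hss
        exact ih H' (by omega) h'
  exact key _ X le_rfl (PathPart.refl X)

theorem ppOn_le [Fintype V] {k : ℕ} (h : HasPathPart E Finset.univ k) :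
    ppOn E Set.univ ≤ k := by
  obtain ⟨H, h, hc⟩ := h
  obtain ⟨P, hP, h1, h2, h3, -⟩ := h.exists_lists
  refine le_trans (Nat.sInf_le ⟨P, rfl, ?_, ?_, h3⟩) (hP.trans hc)
  · exact fun l hl => ⟨(h1 l hl).1, fun v _ => Set.mem_univ v⟩
  · exact fun v _ => h2 v (Finset.mem_univ v)

end HasPathPart

/-! ## Connected locally semicomplete digraphs are traceable -/

section LocallySemicomplete

variable {V : Type} {E : V → V → Prop}

theorem exists_insert_of_arc_to {X : Set V}
    (hin : ∀ v ∈ X, ∀ u ∈ X, ∀ w ∈ X, E u v → E w v → u ≠ w → E u w ∨ E w u)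
    {u v : V} {l₁ l₂ : List V} (hc : (l₁ ++ v :: l₂).IsChain E) (hX : ∀ x ∈ l₁ ++ v :: l₂, x ∈ X)
    (huX : u ∈ X) (hu : u ∉ l₁ ++ v :: l₂) (he : E u v) :
    ∃ l : List V, l.IsChain E ∧ l.Perm (u :: (l₁ ++ v :: l₂)) := by
  induction l₁ using List.reverseRecOn generalizing v l₂ with
  | nil => exact ⟨u :: v :: l₂, List.isChain_cons_cons.2 ⟨he, hc⟩, by simp⟩
  | append_singleton l₁ w ih =>
    have e : l₁ ++ [w] ++ v :: l₂ = l₁ ++ w :: v :: l₂ := by simp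
    rw [e] at hc hX hu ⊢
    have hc' := List.isChain_append_cons_cons.1 hc
    have huw : u ≠ w := by rintro rfl; simp at hu
    by_cases hwu : E w u
    · refine ⟨l₁ ++ w :: u :: v :: l₂, ?_, ?_⟩
      · exact List.isChain_append_cons_cons.2
          ⟨hc'.1, hwu, List.isChain_cons_cons.2 ⟨he, hc'.2.2⟩⟩
      · have : l₁ ++ w :: u :: v :: l₂ = (l₁ ++ [w]) ++ u :: v :: l₂ := by simp
        rw [this]
        refine List.perm_middle.trans ?_
        simp
    · have := hin v (hX v (by simp)) u huX w (hX w (by simp)) he hc'.2.1 huw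
      exact ih hc hX hu (this.resolve_right hwu)

theorem exists_insert_of_arc_from {X : Set V}
    (hout : ∀ v ∈ X, ∀ u ∈ X, ∀ w ∈ X, E v u → E v w → u ≠ w → E u w ∨ E w u)
    {u v : V} {l₁ l₂ : List V} (hc : (l₁ ++ v :: l₂).IsChain E) (hX : ∀ x ∈ l₁ ++ v :: l₂, x ∈ X)
    (huX : u ∈ X) (hu : u ∉ l₁ ++ v :: l₂) (he : E v u) :
    ∃ l : List V, l.IsChain E ∧ l.Perm (u :: (l₁ ++ v :: l₂)) := by
  induction l₂ generalizing v l₁ with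
  | nil =>
    refine ⟨l₁ ++ v :: u :: [], List.isChain_append_cons_cons.2 ⟨hc, he, by simp⟩, ?_⟩
    have : l₁ ++ v :: u :: [] = (l₁ ++ [v]) ++ u :: [] := by simp
    rw [this]
    refine List.perm_middle.trans ?_
    simp
  | cons w l₂ ih =>
    have hc' := List.isChain_append_cons_cons.1 hc
    have huw : u ≠ w := by rintro rfl; simp at hu
    by_cases huw' : E u w
    · refine ⟨l₁ ++ v :: u :: w :: l₂, ?_, ?_⟩
      · exact List.isChain_append_cons_cons.2
          ⟨hc'.1, he, List.isChain_cons_cons.2 ⟨huw', hc'.2.2⟩⟩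
      · have : l₁ ++ v :: u :: w :: l₂ = (l₁ ++ [v]) ++ u :: w :: l₂ := by simp
        rw [this]
        refine List.perm_middle.trans ?_
        simp
    · have e : l₁ ++ v :: w :: l₂ = (l₁ ++ [v]) ++ w :: l₂ := by simp
      have := hout v (hX v (by simp)) u huX w (hX w (by simp)) he hc'.2.1 huw
      rw [e] at hc hX hu ⊢
      exact ih hc hX hu (this.resolve_left huw')

theorem PathPart.of_isChain [DecidableEq V] {h : V} {l : List V} (hn : (h :: l).Nodup)
    (hc : (h :: l).IsChain E) : PathPart E (h :: l).toFinset {h} := by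
  induction l generalizing h with
  | nil => simpa using PathPart.single (E := E) h (by simp) .empty
  | cons a l ih =>
    have hn' := List.nodup_cons.1 hn
    have hc' := List.isChain_cons_cons.1 hc
    have := PathPart.cons h a (by simpa using hn'.1) (Finset.mem_singleton_self a) hc'.1
      (ih hn'.2 hc'.2)
    simpa using this

/-- A connected, locally semicomplete induced subdigraph has a Hamiltonian directed path. -/
theorem HasPathPart.of_locally_semicomplete [DecidableEq V] {X : Finset V}
    (hin : ∀ v ∈ X, ∀ u ∈ X, ∀ w ∈ X, E u v → E w v → u ≠ w → E u w ∨ E w u)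
    (hout : ∀ v ∈ X, ∀ u ∈ X, ∀ w ∈ X, E v u → E v w → u ≠ w → E u w ∨ E w u)
    (hconn : ∀ S ⊆ X, S.Nonempty → S ≠ X → ∃ v ∈ S, ∃ u ∈ X, u ∉ S ∧ (E u v ∨ E v u)) :
    HasPathPart E X 1 := by
  rcases X.eq_empty_or_nonempty with rfl | ⟨x, hx⟩
  · exact HasPathPart.empty.mono (by omega)
  have key : ∀ k, 1 ≤ k → k ≤ X.card →
      ∃ l : List V, l.length = k ∧ l.Nodup ∧ l.IsChain E ∧ ∀ y ∈ l, y ∈ X := by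
    intro k hk
    induction k, hk using Nat.le_induction with
    | base => exact fun _ => ⟨[x], by simp [hx]⟩
    | succ k hk ih =>
      intro hk'
      obtain ⟨l, hl, hnd, hc, hlX⟩ := ih (by omega)
      have hcard : l.toFinset.card = k := by rw [List.toFinset_card_of_nodup hnd, hl]
      obtain ⟨v, hv, u, hu, huS, he⟩ := hconn l.toFinset
        (fun y hy => hlX y (List.mem_toFinset.1 hy))
        (Finset.card_pos.1 (by omega)) (by rintro h; rw [h] at hcard; omega)
      rw [List.mem_toFinset] at hv huS
      obtain ⟨l₁, l₂, rfl⟩ := List.append_of_mem hv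
      obtain ⟨l', hc', hperm⟩ : ∃ l' : List V, l'.IsChain E ∧ l'.Perm (u :: (l₁ ++ v :: l₂)) := by
        rcases he with he | he
        · exact exists_insert_of_arc_to (X := X) hin hc hlX hu huS he
        · exact exists_insert_of_arc_from (X := X) hout hc hlX hu huS he
      refine ⟨l', by rw [hperm.length_eq, List.length_cons, hl], ?_, hc', ?_⟩
      · exact hperm.nodup_iff.2 (List.nodup_cons.2 ⟨huS, hnd⟩)
      · intro y hy
        rcases List.mem_cons.1 (hperm.mem_iff.1 hy) with rfl | hy
        · exact hu
        · exact hlX y hy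
  obtain ⟨l, hl, hnd, hc, hlX⟩ := key X.card (Finset.card_pos.2 ⟨x, hx⟩) le_rfl
  have heq : l.toFinset = X := by
    refine Finset.eq_of_subset_of_card_le (fun y hy => hlX y (List.mem_toFinset.1 hy)) ?_
    rw [List.toFinset_card_of_nodup hnd, hl]
  cases l with
  | nil => simp at heq; rw [← heq] at hx; simp at hx
  | cons a l => exact ⟨{a}, heq ▸ PathPart.of_isChain hnd hc, by simp⟩

end LocallySemicomplete

/-! ## Ramsey numbers -/

theorem exists_ramsey_bound (a b : ℕ) : ∃ R : ℕ, ∀ {V : Type} (G : SimpleGraph V) (s : Finset V),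
    R ≤ s.card → (∃ t ⊆ s, G.IsNClique a t) ∨ (∃ t ⊆ s, Gᶜ.IsNClique b t) := by
  induction a generalizing b with
  | zero => exact ⟨0, fun G s _ => Or.inl ⟨∅, by simp, by simp [SimpleGraph.isNClique_iff]⟩⟩
  | succ a iha =>
    induction b with
    | zero => exact ⟨0, fun G s _ => Or.inr ⟨∅, by simp, by simp [SimpleGraph.isNClique_iff]⟩⟩
    | succ b ihb =>
      obtain ⟨R₁, h₁⟩ := iha (b + 1)
      obtain ⟨R₂, h₂⟩ := ihb
      refine ⟨R₁ + R₂ + 1, fun G s hs => ?_⟩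
      classical
      obtain ⟨v, hv⟩ : s.Nonempty := Finset.card_pos.1 (by omega)
      have hsum := Finset.card_filter_add_card_filter_not (s := s.erase v) (fun w => G.Adj v w)
      rw [Finset.card_erase_of_mem hv] at hsum
      have hsub : ∀ (q : _ → Prop) [DecidablePred q], (s.erase v).filter q ⊆ s := fun q _ =>
        (Finset.filter_subset _ _).trans (Finset.erase_subset _ _)
      by_cases hR : R₁ ≤ ((s.erase v).filter (fun w => G.Adj v w)).card
      · rcases h₁ G _ hR with ⟨t, ht, hc⟩ | ⟨t, ht, hc⟩
        · refine Or.inl ⟨insert v t, Finset.insert_subset hv (ht.trans (hsub _)), hc.insert ?_⟩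
          exact fun w hw => (Finset.mem_filter.1 (ht hw)).2
        · exact Or.inr ⟨t, ht.trans (hsub _), hc⟩
      · rcases h₂ G ((s.erase v).filter (fun w => ¬ G.Adj v w)) (by omega) with
          ⟨t, ht, hc⟩ | ⟨t, ht, hc⟩
        · exact Or.inl ⟨t, ht.trans (hsub _), hc⟩
        · refine Or.inr ⟨insert v t, Finset.insert_subset hv (ht.trans (hsub _)), hc.insert ?_⟩
          intro w hw
          have := Finset.mem_filter.1 (ht hw)
          exact (SimpleGraph.compl_adj _ _ _).2 ⟨(Finset.ne_of_mem_erase this.1).symm, this.2⟩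

theorem ramseyNumber_mem (a b : ℕ) :
    ramseyNumber a b ∈ {R | ∀ m : ℕ, R ≤ m → ∀ G : SimpleGraph (Fin m),
      (∃ s : Finset (Fin m), G.IsNClique a s) ∨ (∃ s : Finset (Fin m), Gᶜ.IsNClique b s)} := by
  apply Nat.sInf_mem
  obtain ⟨R, hR⟩ := exists_ramsey_bound a b
  refine ⟨R, fun m hm G => ?_⟩
  rcases hR G Finset.univ (by simpa using hm) with ⟨t, -, ht⟩ | ⟨t, -, ht⟩
  exacts [Or.inl ⟨t, ht⟩, Or.inr ⟨t, ht⟩]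

theorem exists_clique_or_indep {V : Type} (G : SimpleGraph V) {a b : ℕ} (s : Finset V)
    (hs : ramseyNumber a b ≤ s.card) :
    (∃ t ⊆ s, G.IsNClique a t) ∨ (∃ t ⊆ s, Gᶜ.IsNClique b t) := by
  classical
  let e : Fin s.card ↪ V := s.equivFin.symm.toEmbedding.trans (Function.Embedding.subtype _)
  have hsub : ∀ t : Finset (Fin s.card), t.map e ⊆ s := by
    intro t x hx
    obtain ⟨i, -, rfl⟩ := Finset.mem_map.1 hx
    exact (s.equivFin.symm i).2
  rcases ramseyNumber_mem a b s.card hs (G.comap e) with ⟨t, ht⟩ | ⟨t, ht⟩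
  · refine Or.inl ⟨t.map e, hsub t, ?_⟩
    rw [SimpleGraph.isNClique_iff] at ht ⊢
    refine ⟨?_, by simpa using ht.2⟩
    intro x hx y hy hxy
    simp only [Finset.coe_map, Set.mem_image, Finset.mem_coe] at hx hy
    obtain ⟨i, hi, rfl⟩ := hx
    obtain ⟨j, hj, rfl⟩ := hy
    exact ht.1 hi hj (by rintro rfl; exact hxy rfl)
  · refine Or.inr ⟨t.map e, hsub t, ?_⟩
    rw [SimpleGraph.isNClique_iff] at ht ⊢
    refine ⟨?_, by simpa using ht.2⟩
    intro x hx y hy hxy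
    simp only [Finset.coe_map, Set.mem_image, Finset.mem_coe] at hx hy
    obtain ⟨i, hi, rfl⟩ := hx
    obtain ⟨j, hj, rfl⟩ := hy
    have := ht.1 hi hj (by rintro rfl; exact hxy rfl)
    simp only [SimpleGraph.compl_adj, SimpleGraph.comap_adj] at this ⊢
    exact ⟨hxy, this.2⟩

theorem two_mul_lt_ramseyNumber {n : ℕ} (hn : 3 ≤ n) (m : ℕ) :
    2 * m < ramseyNumber n (m + 1) := by
  by_contra hcon
  have hG := ramseyNumber_mem n (m + 1) (2 * m) (by omega)
    (SimpleGraph.fromRel (fun i j => i.val / 2 = j.val / 2))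
  rcases hG with ⟨s, hs⟩ | ⟨s, hs⟩
  · rw [SimpleGraph.isNClique_iff] at hs
    obtain ⟨x, y, z, hx, hy, hz, hxy, hxz, hyz⟩ := Finset.two_lt_card_iff.1 (by omega : 2 < s.card)
    have h1 := hs.1 hx hy hxy
    have h2 := hs.1 hx hz hxz
    simp only [SimpleGraph.fromRel_adj] at h1 h2
    have e1 : x.val ≠ y.val := fun h => hxy (Fin.ext h)
    have e2 : x.val ≠ z.val := fun h => hxz (Fin.ext h)
    have e3 : y.val ≠ z.val := fun h => hyz (Fin.ext h)
    omega
  · rw [SimpleGraph.isNClique_iff] at hs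
    obtain ⟨x, hx, y, hy, hxy, he⟩ := Finset.exists_ne_map_eq_of_card_lt_of_maps_to
      (s := s) (t := Finset.range m) (f := fun i => i.val / 2) (by simp [hs.2])
      (fun i _ => Finset.mem_coe.2 (Finset.mem_range.2 (by have := i.2; show i.val / 2 < m; omega)))
    have := hs.1 hx hy hxy
    simp only [SimpleGraph.compl_adj, SimpleGraph.fromRel_adj] at this
    exact this.2 ⟨hxy, Or.inl he⟩

/-! ## Independent sets in neighbourhoods -/

/-- Every independent set of `G` inside `X` has at most `a` vertices. -/
def IndepLE {V : Type} (G : SimpleGraph V) (X : Finset V) (a : ℕ) : Prop :=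
  ∀ I ⊆ X, (∀ u ∈ I, ∀ v ∈ I, ¬ G.Adj u v) → I.card ≤ a

section Layers

variable {V : Type} {G : SimpleGraph V} {n : ℕ}

theorem IndepLE.subset {X Y : Finset V} {a : ℕ} (h : IndepLE G X a) (hY : Y ⊆ X) :
    IndepLE G Y a := fun I hI => h I (hI.trans hY)

theorem IndepLE.mono {X : Finset V} {a b : ℕ} (h : IndepLE G X a) (hab : a ≤ b) :
    IndepLE G X b := fun I hI hI' => (h I hI hI').trans hab

theorem card_lt_of_star_free (hstar : ¬ HasInducedCopyG (StarG n) G) {v : V} {I : Finset V}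
    (hI : ∀ x ∈ I, ∀ y ∈ I, ¬ G.Adj x y) (hv : ∀ x ∈ I, G.Adj v x) : I.card < n := by
  by_contra hcon
  obtain ⟨J, hJ, hJn⟩ := Finset.exists_subset_card_eq (not_lt.1 hcon)
  subst hJn
  apply hstar
  have hmem : ∀ i, (J.equivFin.symm i : V) ∈ I := fun i => hJ (J.equivFin.symm i).2
  refine ⟨Sum.elim (fun _ => v) (fun i => J.equivFin.symm i), ?_, ?_⟩
  · rintro (a | a) (b | b) hab
    · rfl
    · exact absurd hab (hv _ (hmem b)).ne
    · exact absurd hab.symm (hv _ (hmem a)).ne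
    · simpa [Subtype.ext_iff.symm] using hab
  · rintro (a | a) (b | b)
    · simp [StarG]
    · simp [StarG, hv _ (hmem b)]
    · simp [StarG, (hv _ (hmem a)).symm]
    · simp [StarG, hI _ (hmem a) _ (hmem b)]

/-- A clique of size `n` whose vertices have independent private neighbours is a `K*_n`. -/
theorem not_clique_of_private (hK : ¬ HasInducedCopyG (KStarG n) G) {t : Finset V}
    (ht : G.IsNClique n t) {y : V → V} (hy : ∀ x ∈ t, G.Adj x (y x))
    (hpriv : ∀ x ∈ t, ∀ x' ∈ t, x ≠ x' → x ≠ y x' ∧ ¬ G.Adj x (y x') ∧ ¬ G.Adj (y x) (y x')) :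
    False := by
  rw [SimpleGraph.isNClique_iff] at ht
  obtain ⟨hcl, rfl⟩ := ht
  apply hK
  have hmem : ∀ i, (t.equivFin.symm i : V) ∈ t := fun i => (t.equivFin.symm i).2
  have hinj : ∀ i j, i ≠ j → (t.equivFin.symm i : V) ≠ t.equivFin.symm j := by
    intro i j hij h
    exact hij (t.equivFin.symm.injective (Subtype.ext h))
  have hne : ∀ i j, (t.equivFin.symm i : V) ≠ y (t.equivFin.symm j) := by
    intro i j
    by_cases hij : i = j
    · subst hij
      exact (hy _ (hmem i)).ne
    · exact (hpriv _ (hmem i) _ (hmem j) (hinj i j hij)).1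
  refine ⟨Sum.elim (fun i => t.equivFin.symm i) (fun i => y (t.equivFin.symm i)), ?_, ?_⟩
  · rintro (i | i) (j | j) hij
    · simpa [Subtype.ext_iff.symm] using hij
    · exact absurd hij (hne i j)
    · exact absurd hij.symm (hne j i)
    · by_contra hcon
      have hij' : i ≠ j := fun h => hcon (by rw [h])
      have h1 := (hpriv _ (hmem i) _ (hmem j) (hinj i j hij')).2.1
      simp only [Sum.elim_inr] at hij
      rw [← hij] at h1
      exact h1 (hy _ (hmem i))
  · rintro (i | i) (j | j)
    · by_cases hij : i = j
      · subst hij; simp [KStarG]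
      · have := hcl (hmem i) (hmem j) (hinj i j hij)
        simp [KStarG, this, hij]
    · by_cases hij : i = j
      · subst hij; simp [KStarG, hy _ (hmem i)]
      · simp [KStarG, (hpriv _ (hmem i) _ (hmem j) (hinj i j hij)).2.1, hij]
    · by_cases hij : i = j
      · subst hij; simp [KStarG, (hy _ (hmem i)).symm]
      · have := (hpriv _ (hmem j) _ (hmem i) (hinj j i (Ne.symm hij))).2.1
        rw [SimpleGraph.adj_comm] at this
        simp [KStarG, this, Ne.symm hij]
    · by_cases hij : i = j
      · subst hij; simp [KStarG]
      · simp [KStarG, (hpriv _ (hmem i) _ (hmem j) (hinj i j hij)).2.2]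

/-- The independence number of a set dominated by `X` is controlled by that of `X`. -/
theorem IndepLE.of_dominated (hn : 2 ≤ n) (hK : ¬ HasInducedCopyG (KStarG n) G)
    (hstar : ¬ HasInducedCopyG (StarG n) G) {X Y : Finset V} {a : ℕ} (hX : IndepLE G X a)
    (hdisj : ∀ x ∈ X, x ∉ Y) (hdom : ∀ y ∈ Y, ∃ x ∈ X, G.Adj x y) :
    IndepLE G Y ((n - 1) * ramseyNumber n (a + 1) - 1) := by
  classical
  intro I hIY hI
  suffices h : I.card < (n - 1) * ramseyNumber n (a + 1) by omega
  by_contra hcon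
  obtain ⟨Z, hZ, hmin⟩ := Finset.exists_min_image
    (X.powerset.filter (fun Z => ∀ y ∈ I, ∃ x ∈ Z, G.Adj x y)) Finset.card
    ⟨X, by simpa using fun y hy => hdom y (hIY hy)⟩
  simp only [Finset.mem_filter, Finset.mem_powerset] at hZ
  obtain ⟨hZX, hZdom⟩ := hZ
  have hpriv : ∀ x ∈ Z, ∃ y ∈ I, G.Adj x y ∧ ∀ x' ∈ Z, x' ≠ x → ¬ G.Adj x' y := by
    intro x hx
    by_contra hno
    push Not at hno
    have := hmin (Z.erase x) (by
      simp only [Finset.mem_filter, Finset.mem_powerset]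
      refine ⟨(Finset.erase_subset _ _).trans hZX, fun y hy => ?_⟩
      obtain ⟨z, hz, hzy⟩ := hZdom y hy
      by_cases hzx : z = x
      · subst hzx
        obtain ⟨x', hx', hne, hadj⟩ := hno y hy hzy
        exact ⟨x', by simp [hx', hne], hadj⟩
      · exact ⟨z, by simp [hz, hzx], hzy⟩)
    rw [Finset.card_erase_of_mem hx] at this
    have := Finset.card_pos.2 ⟨x, hx⟩
    omega
  choose! y hyI hyadj hyp using hpriv
  have hcard : I.card ≤ Z.card * (n - 1) := by
    have hsub : I ⊆ Z.biUnion (fun x => I.filter (fun y => G.Adj x y)) := by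
      intro w hw
      obtain ⟨x, hx, hxw⟩ := hZdom w hw
      exact Finset.mem_biUnion.2 ⟨x, hx, by simp [hw, hxw]⟩
    refine (Finset.card_le_card hsub).trans (Finset.card_biUnion_le_card_mul _ _ _ ?_)
    intro x hx
    have := card_lt_of_star_free hstar (v := x) (I := I.filter (fun y => G.Adj x y))
      (fun u hu v hv => hI u (Finset.mem_filter.1 hu).1 v (Finset.mem_filter.1 hv).1)
      (fun u hu => (Finset.mem_filter.1 hu).2)
    omega
  have hR : ramseyNumber n (a + 1) ≤ Z.card := by
    by_contra hlt
    have h1 : Z.card * (n - 1) < ramseyNumber n (a + 1) * (n - 1) :=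
      Nat.mul_lt_mul_of_pos_right (not_le.1 hlt) (by omega)
    rw [mul_comm (n - 1)] at hcon
    omega
  rcases exists_clique_or_indep G Z hR with ⟨t, ht, hcl⟩ | ⟨t, ht, hcl⟩
  · refine not_clique_of_private hK hcl (fun x hx => hyadj x (ht hx)) ?_
    intro x hx x' hx' hne
    refine ⟨?_, hyp x' (ht hx') x (ht hx) hne, hI _ (hyI x (ht hx)) _ (hyI x' (ht hx'))⟩
    intro h
    exact hdisj x (hZX (ht hx)) (hIY (h ▸ hyI x' (ht hx')))
  · rw [SimpleGraph.isNClique_iff] at hcl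
    have := hX t (ht.trans hZX) (fun u hu v hv huv => by
      have := hcl.1 hu hv huv.ne
      rw [SimpleGraph.compl_adj] at this
      exact this.2 huv)
    omega

/-- Vertices at distance at most `i` from `X`. -/
noncomputable def ballFinset [Fintype V] (G : SimpleGraph V) (X : Finset V) : ℕ → Finset V
  | 0 => X
  | i + 1 => by
      classical
      exact Finset.univ.filter (fun v => v ∈ ballFinset G X i ∨
        ∃ u ∈ ballFinset G X i, G.Adj u v)

theorem mem_ballFinset_succ [Fintype V] {X : Finset V} {i : ℕ} {v : V} :
    v ∈ ballFinset G X (i + 1) ↔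
      v ∈ ballFinset G X i ∨ ∃ u ∈ ballFinset G X i, G.Adj u v := by
  simp [ballFinset]

theorem ballFinset_mono [Fintype V] {X : Finset V} {i j : ℕ} (hij : i ≤ j) :
    ballFinset G X i ⊆ ballFinset G X j := by
  induction j, hij using Nat.le_induction with
  | base => exact subset_rfl
  | succ j _ ih => exact fun v hv => mem_ballFinset_succ.2 (Or.inl (ih hv))

/-- Vertices at distance exactly `i` from `X`. -/
noncomputable def layerFinset [Fintype V] [DecidableEq V] (G : SimpleGraph V) (X : Finset V) :
    ℕ → Finset V
  | 0 => X
  | i + 1 => ballFinset G X (i + 1) \ ballFinset G X i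

variable [Fintype V] [DecidableEq V]

theorem layerFinset_subset_ball {X : Finset V} (i : ℕ) :
    layerFinset G X i ⊆ ballFinset G X i := by
  cases i with
  | zero => exact subset_rfl
  | succ i => exact Finset.sdiff_subset

theorem layerFinset_disjoint {X : Finset V} {i j : ℕ} (hij : i ≠ j) :
    Disjoint (layerFinset G X i) (layerFinset G X j) := by
  wlog h : i < j generalizing i j
  · exact (this hij.symm (by omega)).symm
  obtain ⟨j, rfl⟩ : ∃ k, j = k + 1 := ⟨j - 1, by omega⟩
  rw [Finset.disjoint_left]
  intro v hv hv'
  exact (Finset.mem_sdiff.1 hv').2 (ballFinset_mono (by omega) (layerFinset_subset_ball i hv))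

theorem ballFinset_eq_biUnion {X : Finset V} (i : ℕ) :
    ballFinset G X i = (Finset.range (i + 1)).biUnion (layerFinset G X) := by
  induction i with
  | zero => simp [ballFinset, layerFinset]
  | succ i ih =>
    rw [Finset.range_add_one, Finset.biUnion_insert, ← ih]
    simp only [layerFinset]
    rw [Finset.sdiff_union_of_subset (ballFinset_mono (by omega))]

theorem exists_adj_of_mem_layer {X : Finset V} {i : ℕ} {v : V} (hv : v ∈ layerFinset G X (i + 1)) :
    ∃ u ∈ layerFinset G X i, G.Adj u v := by
  have h := Finset.mem_sdiff.1 hv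
  obtain ⟨u, hu, huv⟩ := (mem_ballFinset_succ.1 h.1).resolve_left h.2
  refine ⟨u, ?_, huv⟩
  cases i with
  | zero => exact hu
  | succ i =>
    refine Finset.mem_sdiff.2 ⟨hu, fun hu' => h.2 (mem_ballFinset_succ.2 (Or.inr ⟨u, hu', huv⟩))⟩

theorem IndepLE.layer_succ (hn : 2 ≤ n) (hK : ¬ HasInducedCopyG (KStarG n) G)
    (hstar : ¬ HasInducedCopyG (StarG n) G) {X : Finset V} {i a : ℕ}
    (h : IndepLE G (layerFinset G X i) a) :
    IndepLE G (layerFinset G X (i + 1)) ((n - 1) * ramseyNumber n (a + 1) - 1) := by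
  refine h.of_dominated hn hK hstar ?_ (fun y hy => exists_adj_of_mem_layer hy)
  exact fun x hx hx' => Finset.disjoint_left.1 (layerFinset_disjoint (by omega)) hx hx'

end Layers

/-! ## Induced sequences and the forbidden configurations -/

section Sequences

variable {V : Type} (G : SimpleGraph V)

/-- The vertices `q 0, …, q (m - 1)` form an induced path in this order. -/
def IndSeq (q : ℕ → V) (m : ℕ) : Prop :=
  ∀ i j, i < j → j < m → q i ≠ q j ∧ (G.Adj (q i) (q j) ↔ j = i + 1)

/-- The only neighbour of `x` among `q 0, …, q (m - 1)` is `q 0`. -/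
def Only (x : V) (q : ℕ → V) (m : ℕ) : Prop := ∀ i < m, x ≠ q i ∧ (G.Adj x (q i) ↔ i = 0)

/-- `x` is distinct from and not adjacent to `q 0, …, q (m - 1)`. -/
def Off (x : V) (q : ℕ → V) (m : ℕ) : Prop := ∀ i < m, x ≠ q i ∧ ¬ G.Adj x (q i)

/-- The two sequences are disjoint and there are no edges between them. -/
def Apart (y z : ℕ → V) (m : ℕ) : Prop := ∀ i < m, ∀ j < m, y i ≠ z j ∧ ¬ G.Adj (y i) (z j)

/-- The two sequences are disjoint and the only edge between them joins their first vertices. -/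
def Link (y z : ℕ → V) (m : ℕ) : Prop :=
  ∀ i < m, ∀ j < m, y i ≠ z j ∧ (G.Adj (y i) (z j) ↔ i = 0 ∧ j = 0)

/-- Prepend a vertex to a sequence. -/
def seqCons (a : V) (q : ℕ → V) : ℕ → V
  | 0 => a
  | i + 1 => q i

@[simp] theorem seqCons_zero (a : V) (q : ℕ → V) : seqCons a q 0 = a := rfl
@[simp] theorem seqCons_succ (a : V) (q : ℕ → V) (i : ℕ) : seqCons a q (i + 1) = q i := rfl

/-- The sequence `p l, p (l - 1), …`. -/
def armL (p : ℕ → V) (l : ℕ) : ℕ → V := fun i => p (l - i)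

/-- The sequence `p r, p (r + 1), …`. -/
def armR (p : ℕ → V) (r : ℕ) : ℕ → V := fun i => p (r + i)

variable {G} {q y z : ℕ → V} {m : ℕ} {a x : V}

theorem IndSeq.ne (h : IndSeq G q m) {i j : ℕ} (hi : i < m) (hj : j < m) (hij : i ≠ j) :
    q i ≠ q j := by
  rcases Nat.lt_or_gt_of_ne hij with h' | h'
  · exact (h i j h' hj).1
  · exact (h j i h' hi).1.symm

theorem IndSeq.adj_iff (h : IndSeq G q m) {i j : ℕ} (hi : i < m) (hj : j < m) :
    G.Adj (q i) (q j) ↔ i + 1 = j ∨ j + 1 = i := by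
  rcases lt_trichotomy i j with h' | h' | h'
  · rw [(h i j h' hj).2]; omega
  · subst h'; simp
  · rw [G.adj_comm, (h j i h' hi).2]; omega

theorem IndSeq.mono {k : ℕ} (h : IndSeq G q m) (hk : k ≤ m) : IndSeq G q k :=
  fun i j hij hj => h i j hij (hj.trans_le hk)

theorem Apart.symm (h : Apart G y z m) : Apart G z y m :=
  fun i hi j hj => ⟨(h j hj i hi).1.symm, fun h' => (h j hj i hi).2 h'.symm⟩

theorem Link.symm (h : Link G y z m) : Link G z y m :=
  fun i hi j hj => ⟨(h j hj i hi).1.symm, by rw [G.adj_comm, (h j hj i hi).2, and_comm]⟩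

theorem IndSeq.cons_succ (h : IndSeq G q m) (ha : Only G a q m) :
    IndSeq G (seqCons a q) (m + 1) := by
  intro i j hij hj
  obtain ⟨j, rfl⟩ : ∃ k, j = k + 1 := ⟨j - 1, by omega⟩
  cases i with
  | zero =>
    have := ha j (by omega)
    simpa using this
  | succ i =>
    have := h i j (by omega) (by omega)
    simpa using this

theorem IndSeq.cons (h : IndSeq G q m) (ha : Only G a q m) : IndSeq G (seqCons a q) m :=
  (h.cons_succ ha).mono (by omega)

theorem Only.cons (hxa : G.Adj x a) (hx : Off G x q m) : Only G x (seqCons a q) m := by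
  intro i hi
  cases i with
  | zero => simpa using ⟨hxa.ne, hxa⟩
  | succ i => simpa using hx i (by omega)

theorem Off.cons (hne : x ≠ a) (hxa : ¬ G.Adj x a) (hx : Off G x q m) :
    Off G x (seqCons a q) m := by
  intro i hi
  cases i with
  | zero => simpa using ⟨hne, hxa⟩
  | succ i => simpa using hx i (by omega)

theorem Apart.cons (h : Apart G y z m) (ha : Off G a y m) : Apart G y (seqCons a z) m := by
  intro i hi j hj
  cases j with
  | zero => exact ⟨(ha i hi).1.symm, fun h' => (ha i hi).2 h'.symm⟩
  | succ j => exact h i hi j (by omega)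

theorem Apart.consLink (h : Apart G y z m) (ha : Only G a y m) : Link G y (seqCons a z) m := by
  intro i hi j hj
  cases j with
  | zero =>
    refine ⟨(ha i hi).1.symm, ?_⟩
    rw [G.adj_comm]
    simpa using (ha i hi).2
  | succ j => simpa using h i hi j (by omega)

end Sequences

section Forbidden

variable {V : Type} {G : SimpleGraph V} {n : ℕ} {y z : ℕ → V} {x x₁ x₂ : V}

theorem hasInducedCopyG_of_arms {H : SimpleGraph (Fin 2 ⊕ Fin n ⊕ Fin n)}
    (hy : IndSeq G y n) (hz : IndSeq G z n) (hx : x₁ ≠ x₂)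
    (h12 : G.Adj x₁ x₂ ↔ H.Adj (.inl 0) (.inl 1))
    (h1y : ∀ j : Fin n, x₁ ≠ y j ∧ (G.Adj x₁ (y j) ↔ H.Adj (.inl 0) (.inr (.inl j))))
    (h1z : ∀ j : Fin n, x₁ ≠ z j ∧ (G.Adj x₁ (z j) ↔ H.Adj (.inl 0) (.inr (.inr j))))
    (h2y : ∀ j : Fin n, x₂ ≠ y j ∧ (G.Adj x₂ (y j) ↔ H.Adj (.inl 1) (.inr (.inl j))))
    (h2z : ∀ j : Fin n, x₂ ≠ z j ∧ (G.Adj x₂ (z j) ↔ H.Adj (.inl 1) (.inr (.inr j))))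
    (hyz : ∀ i j : Fin n, y i ≠ z j ∧
      (G.Adj (y i) (z j) ↔ H.Adj (.inr (.inl i)) (.inr (.inr j))))
    (Hy : ∀ i j : Fin n, H.Adj (.inr (.inl i)) (.inr (.inl j)) ↔
      (i.val + 1 = j.val ∨ j.val + 1 = i.val))
    (Hz : ∀ i j : Fin n, H.Adj (.inr (.inr i)) (.inr (.inr j)) ↔
      (i.val + 1 = j.val ∨ j.val + 1 = i.val)) :
    HasInducedCopyG H G := by
  have key : ∀ (i : Fin 2) (j : Fin n),
      ((![x₁, x₂] i ≠ y j) ∧ (G.Adj (![x₁, x₂] i) (y j) ↔ H.Adj (.inl i) (.inr (.inl j)))) ∧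
      ((![x₁, x₂] i ≠ z j) ∧ (G.Adj (![x₁, x₂] i) (z j) ↔ H.Adj (.inl i) (.inr (.inr j)))) := by
    intro i j
    fin_cases i
    · exact ⟨h1y j, h1z j⟩
    · exact ⟨h2y j, h2z j⟩
  refine ⟨Sum.elim ![x₁, x₂] (Sum.elim (fun i => y i) (fun i => z i)), ?_, ?_⟩
  · rintro (i | i | i) (j | j | j) hij
    · fin_cases i <;> fin_cases j
      · rfl
      · exact absurd hij hx
      · exact absurd hij hx.symm
      · rfl
    · exact absurd hij (key i j).1.1
    · exact absurd hij (key i j).2.1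
    · exact absurd hij.symm (key j i).1.1
    · by_contra hne
      exact hy.ne i.2 j.2 (fun h => hne (by rw [Fin.ext h])) hij
    · exact absurd hij (hyz i j).1
    · exact absurd hij.symm (key j i).2.1
    · exact absurd hij.symm (hyz j i).1
    · by_contra hne
      exact hz.ne i.2 j.2 (fun h => hne (by rw [Fin.ext h])) hij
  · rintro (i | i | i) (j | j | j)
    · fin_cases i <;> fin_cases j
      · simp
      · exact h12
      · rw [G.adj_comm, H.adj_comm]; exact h12
      · simp
    · exact (key i j).1.2
    · exact (key i j).2.2
    · rw [G.adj_comm, H.adj_comm]; exact (key j i).1.2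
    · rw [Hy]; exact hy.adj_iff i.2 j.2
    · exact (hyz i j).2
    · rw [G.adj_comm, H.adj_comm]; exact (key j i).2.2
    · rw [G.adj_comm, H.adj_comm]; exact (hyz j i).2
    · rw [Hz]; exact hz.adj_iff i.2 j.2

/-- `G` contains none of the four graphs `F^(k)_n` as an induced subgraph. -/
structure ArmFree (n : ℕ) (G : SimpleGraph V) : Prop where
  f1 : ¬ HasInducedCopyG (F1G n) G
  f2 : ¬ HasInducedCopyG (F2G n) G
  f3 : ¬ HasInducedCopyG (F3G n) G
  f4 : ¬ HasInducedCopyG (F4G n) G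

theorem path_rel_iff (i j : Fin n) :
    (i ≠ j ∧ (i.val + 1 = j.val ∨ j.val + 1 = i.val)) ↔
      (i.val + 1 = j.val ∨ j.val + 1 = i.val) := by
  refine ⟨fun h => h.2, fun h => ⟨?_, h⟩⟩
  rintro rfl
  omega

theorem ArmFree.noF1 (h : ArmFree n G) (hy : IndSeq G y n) (hz : IndSeq G z n)
    (hyz : Apart G y z n) (h1y : Only G x₁ y n) (h1z : Only G x₁ z n) (h2y : Off G x₂ y n)
    (h2z : Off G x₂ z n) (h12 : G.Adj x₁ x₂) : False := by
  refine h.f1 (hasInducedCopyG_of_arms hy hz h12.ne ?_ ?_ ?_ ?_ ?_ ?_ ?_ ?_)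
  · simpa [F1G] using h12
  · exact fun j => ⟨(h1y j j.2).1, by simpa [F1G] using (h1y j j.2).2⟩
  · exact fun j => ⟨(h1z j j.2).1, by simpa [F1G] using (h1z j j.2).2⟩
  · exact fun j => ⟨(h2y j j.2).1, by simpa [F1G] using (h2y j j.2).2⟩
  · exact fun j => ⟨(h2z j j.2).1, by simpa [F1G] using (h2z j j.2).2⟩
  · exact fun i j => ⟨(hyz i i.2 j j.2).1, by simpa [F1G] using (hyz i i.2 j j.2).2⟩
  · intro i j; simpa [F1G] using path_rel_iff i j
  · intro i j; simpa [F1G] using path_rel_iff i j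

theorem ArmFree.noF2 (h : ArmFree n G) (hy : IndSeq G y n) (hz : IndSeq G z n)
    (hyz : Link G y z n) (h1y : Only G x₁ y n) (h1z : Only G x₁ z n) (h2y : Off G x₂ y n)
    (h2z : Off G x₂ z n) (h12 : G.Adj x₁ x₂) : False := by
  refine h.f2 (hasInducedCopyG_of_arms hy hz h12.ne ?_ ?_ ?_ ?_ ?_ ?_ ?_ ?_)
  · simpa [F2G, F1G, YZEdgeG] using h12
  · exact fun j => ⟨(h1y j j.2).1, by simpa [F2G, F1G, YZEdgeG] using (h1y j j.2).2⟩
  · exact fun j => ⟨(h1z j j.2).1, by simpa [F2G, F1G, YZEdgeG] using (h1z j j.2).2⟩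
  · exact fun j => ⟨(h2y j j.2).1, by simpa [F2G, F1G, YZEdgeG] using (h2y j j.2).2⟩
  · exact fun j => ⟨(h2z j j.2).1, by simpa [F2G, F1G, YZEdgeG] using (h2z j j.2).2⟩
  · exact fun i j => ⟨(hyz i i.2 j j.2).1, by
      simpa [F2G, F1G, YZEdgeG] using (hyz i i.2 j j.2).2⟩
  · intro i j; simpa [F2G, F1G, YZEdgeG] using path_rel_iff i j
  · intro i j; simpa [F2G, F1G, YZEdgeG] using path_rel_iff i j

theorem ArmFree.noF3 (h : ArmFree n G) (hy : IndSeq G y n) (hz : IndSeq G z n)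
    (hyz : Apart G y z n) (h1y : Only G x₁ y n) (h1z : Only G x₁ z n) (h2y : Only G x₂ y n)
    (h2z : Only G x₂ z n) (hne : x₁ ≠ x₂) : G.Adj x₁ x₂ := by
  by_contra h12
  refine h.f3 (hasInducedCopyG_of_arms hy hz hne ?_ ?_ ?_ ?_ ?_ ?_ ?_ ?_)
  · simpa [F3G] using h12
  · exact fun j => ⟨(h1y j j.2).1, by simpa [F3G] using (h1y j j.2).2⟩
  · exact fun j => ⟨(h1z j j.2).1, by simpa [F3G] using (h1z j j.2).2⟩
  · exact fun j => ⟨(h2y j j.2).1, by simpa [F3G] using (h2y j j.2).2⟩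
  · exact fun j => ⟨(h2z j j.2).1, by simpa [F3G] using (h2z j j.2).2⟩
  · exact fun i j => ⟨(hyz i i.2 j j.2).1, by simpa [F3G] using (hyz i i.2 j j.2).2⟩
  · intro i j; simpa [F3G] using path_rel_iff i j
  · intro i j; simpa [F3G] using path_rel_iff i j

theorem ArmFree.noF4 (h : ArmFree n G) (hy : IndSeq G y n) (hz : IndSeq G z n)
    (hyz : Link G y z n) (h1y : Only G x₁ y n) (h1z : Only G x₁ z n) (h2y : Only G x₂ y n)
    (h2z : Only G x₂ z n) (hne : x₁ ≠ x₂) : G.Adj x₁ x₂ := by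
  by_contra h12
  refine h.f4 (hasInducedCopyG_of_arms hy hz hne ?_ ?_ ?_ ?_ ?_ ?_ ?_ ?_)
  · simpa [F4G, F3G, YZEdgeG] using h12
  · exact fun j => ⟨(h1y j j.2).1, by simpa [F4G, F3G, YZEdgeG] using (h1y j j.2).2⟩
  · exact fun j => ⟨(h1z j j.2).1, by simpa [F4G, F3G, YZEdgeG] using (h1z j j.2).2⟩
  · exact fun j => ⟨(h2y j j.2).1, by simpa [F4G, F3G, YZEdgeG] using (h2y j j.2).2⟩
  · exact fun j => ⟨(h2z j j.2).1, by simpa [F4G, F3G, YZEdgeG] using (h2z j j.2).2⟩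
  · exact fun i j => ⟨(hyz i i.2 j j.2).1, by
      simpa [F4G, F3G, YZEdgeG] using (hyz i i.2 j j.2).2⟩
  · intro i j; simpa [F4G, F3G, YZEdgeG] using path_rel_iff i j
  · intro i j; simpa [F4G, F3G, YZEdgeG] using path_rel_iff i j

end Forbidden

section DirectedForbidden

variable {V : Type} {E : V → V → Prop} {n : ℕ} {y z : ℕ → V} {x : V}

theorem fromRel_adj_iff (hE : ∀ u v, E u v → ¬ E v u) {u v : V} :
    (SimpleGraph.fromRel E).Adj u v ↔ E u v ∨ E v u := by
  rw [SimpleGraph.fromRel_adj]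
  refine ⟨fun h => h.2, fun h => ⟨?_, h⟩⟩
  rintro rfl
  have : E u u := by tauto
  exact hE _ _ this this

theorem IndSeq.arc_iff (hE : ∀ u v, E u v → ¬ E v u) {m : ℕ}
    (hy : IndSeq (SimpleGraph.fromRel E) y m) (dy : ∀ i, i + 1 < m → E (y i) (y (i + 1)))
    {i j : ℕ} (hi : i < m) (hj : j < m) : E (y i) (y j) ↔ i + 1 = j := by
  refine ⟨fun h => ?_, fun h => ?_⟩
  · rcases (hy.adj_iff hi hj).1 ((fromRel_adj_iff hE).2 (Or.inl h)) with h' | h'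
    · exact h'
    · subst h'
      exact absurd h (hE _ _ (dy j hi))
  · subst h
    exact dy i hj

theorem IndSeq.arc_iff_rev (hE : ∀ u v, E u v → ¬ E v u) {m : ℕ}
    (hy : IndSeq (SimpleGraph.fromRel E) y m) (dy : ∀ i, i + 1 < m → E (y (i + 1)) (y i))
    {i j : ℕ} (hi : i < m) (hj : j < m) : E (y i) (y j) ↔ j + 1 = i := by
  refine ⟨fun h => ?_, fun h => ?_⟩
  · rcases (hy.adj_iff hi hj).1 ((fromRel_adj_iff hE).2 (Or.inl h)) with h' | h'
    · subst h'
      exact absurd h (hE _ _ (dy i hj))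
    · exact h'
  · subst h
    exact dy j hi

theorem digraphHasInducedCopy_of_arms {H : (Unit ⊕ Fin n ⊕ Fin n) → (Unit ⊕ Fin n ⊕ Fin n) → Prop}
    (hE : ∀ u v, E u v → ¬ E v u)
    (hy : IndSeq (SimpleGraph.fromRel E) y n) (hz : IndSeq (SimpleGraph.fromRel E) z n)
    (hyz : Link (SimpleGraph.fromRel E) y z n)
    (hxy : ∀ j < n, x ≠ y j) (hxz : ∀ j < n, x ≠ z j)
    (dy : ∀ i, i + 1 < n → E (y (i + 1)) (y i)) (dyz : E (y 0) (z 0))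
    (dz : ∀ i, i + 1 < n → E (z i) (z (i + 1)))
    (Hx : ¬ H (.inl ()) (.inl ()))
    (Hy : ∀ i j : Fin n, H (.inr (.inl i)) (.inr (.inl j)) ↔ j.val + 1 = i.val)
    (Hz : ∀ i j : Fin n, H (.inr (.inr i)) (.inr (.inr j)) ↔ i.val + 1 = j.val)
    (Hyz : ∀ i j : Fin n, H (.inr (.inl i)) (.inr (.inr j)) ↔ i.val = 0 ∧ j.val = 0)
    (Hzy : ∀ i j : Fin n, ¬ H (.inr (.inr i)) (.inr (.inl j)))
    (Hxy : ∀ j : Fin n, E x (y j) ↔ H (.inl ()) (.inr (.inl j)))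
    (Hyx : ∀ j : Fin n, E (y j) x ↔ H (.inr (.inl j)) (.inl ()))
    (Hxz : ∀ j : Fin n, E x (z j) ↔ H (.inl ()) (.inr (.inr j)))
    (Hzx : ∀ j : Fin n, E (z j) x ↔ H (.inr (.inr j)) (.inl ())) :
    DigraphHasInducedCopy H E := by
  refine ⟨Sum.elim (fun _ => x) (Sum.elim (fun i => y i) (fun i => z i)), ?_, ?_⟩
  · rintro (i | i | i) (j | j | j) hij
    · rfl
    · exact absurd hij (hxy j j.2)
    · exact absurd hij (hxz j j.2)
    · exact absurd hij.symm (hxy i i.2)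
    · by_contra hne
      exact hy.ne i.2 j.2 (fun h => hne (by rw [Fin.ext h])) hij
    · exact absurd hij (hyz i i.2 j j.2).1
    · exact absurd hij.symm (hxz i i.2)
    · exact absurd hij.symm (hyz j j.2 i i.2).1
    · by_contra hne
      exact hz.ne i.2 j.2 (fun h => hne (by rw [Fin.ext h])) hij
  · have hyz0 : ∀ i j : Fin n, E (y i) (z j) ∨ E (z j) (y i) → i.val = 0 ∧ j.val = 0 :=
      fun i j h => (hyz i i.2 j j.2).2.1 ((fromRel_adj_iff hE).2 h)
    rintro (i | i | i) (j | j | j)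
    · simpa [Hx] using fun h => hE _ _ h h
    · exact Hxy j
    · exact Hxz j
    · exact Hyx i
    · rw [Hy]; exact hy.arc_iff_rev hE dy i.2 j.2
    · rw [Hyz]
      refine ⟨fun h => hyz0 i j (Or.inl h), fun h => ?_⟩
      simpa [h.1, h.2] using dyz
    · exact Hzx i
    · refine iff_of_false (fun h => ?_) (Hzy i j)
      have h0 := hyz0 j i (Or.inr h)
      simp only [Sum.elim_inr, Sum.elim_inl, h0.1, h0.2] at h
      exact hE _ _ dyz h
    · rw [Hz]; exact hz.arc_iff hE dz i.2 j.2

/-- In a digraph satisfying (D2), a vertex attached to the middle arc of a long directed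
induced path can be inserted into it. -/
theorem CondD2.insert_middle (h2 : CondD2 n E) (hn : 0 < n) (hE : ∀ u v, E u v → ¬ E v u)
    (hy : IndSeq (SimpleGraph.fromRel E) y n) (hz : IndSeq (SimpleGraph.fromRel E) z n)
    (hyz : Link (SimpleGraph.fromRel E) y z n)
    (hxy : Only (SimpleGraph.fromRel E) x y n) (hxz : Only (SimpleGraph.fromRel E) x z n)
    (dy : ∀ i, i + 1 < n → E (y (i + 1)) (y i)) (dyz : E (y 0) (z 0))
    (dz : ∀ i, i + 1 < n → E (z i) (z (i + 1))) : E (y 0) x ∧ E x (z 0) := by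
  have hy0 : E x (y 0) ∨ E (y 0) x := (fromRel_adj_iff hE).1 ((hxy 0 hn).2.2 rfl)
  have hz0 : E x (z 0) ∨ E (z 0) x := (fromRel_adj_iff hE).1 ((hxz 0 hn).2.2 rfl)
  have fy : ∀ j : Fin n, E x (y j) ∨ E (y j) x → j.val = 0 :=
    fun j h => (hxy j j.2).2.1 ((fromRel_adj_iff hE).2 h)
  have fz : ∀ j : Fin n, E x (z j) ∨ E (z j) x → j.val = 0 :=
    fun j h => (hxz j j.2).2.1 ((fromRel_adj_iff hE).2 h)
  have iffT : ∀ {q : ℕ → V} (j : Fin n), (E x (q j) ∨ E (q j) x → j.val = 0) → E x (q 0) →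
      ((E x (q j) ↔ j.val = 0) ∧ ¬ E (q j) x) := by
    intro q j hj h0
    refine ⟨⟨fun h => hj (Or.inl h), fun h => by rwa [h]⟩, fun h => ?_⟩
    rw [hj (Or.inr h)] at h
    exact hE _ _ h h0
  have iffF : ∀ {q : ℕ → V} (j : Fin n), (E x (q j) ∨ E (q j) x → j.val = 0) → E (q 0) x →
      ((E (q j) x ↔ j.val = 0) ∧ ¬ E x (q j)) := by
    intro q j hj h0
    refine ⟨⟨fun h => hj (Or.inr h), fun h => by rwa [h]⟩, fun h => ?_⟩
    rw [hj (Or.inl h)] at h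
    exact hE _ _ h h0
  have nexy : ∀ j < n, x ≠ y j := fun j hj => (hxy j hj).1
  have nexz : ∀ j < n, x ≠ z j := fun j hj => (hxz j hj).1
  rcases hy0 with ey | ey <;> rcases hz0 with ez | ez
  · refine absurd (digraphHasInducedCopy_of_arms (H := D2Rel n) hE hy hz hyz nexy nexz dy dyz dz
      ?_ ?_ ?_ ?_ ?_ ?_ ?_ ?_ ?_) h2.2.1 <;>
      simp only [D2Rel, implies_true, not_false_eq_true]
    · exact fun j => (iffT j (fy j) ey).1
    · exact fun j => iff_false_intro (iffT j (fy j) ey).2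
    · exact fun j => (iffT j (fz j) ez).1
    · exact fun j => iff_false_intro (iffT j (fz j) ez).2
  · refine absurd (digraphHasInducedCopy_of_arms (H := D1Rel n) hE hy hz hyz nexy nexz dy dyz dz
      ?_ ?_ ?_ ?_ ?_ ?_ ?_ ?_ ?_) h2.1 <;>
      simp only [D1Rel, implies_true, not_false_eq_true]
    · exact fun j => (iffT j (fy j) ey).1
    · exact fun j => iff_false_intro (iffT j (fy j) ey).2
    · exact fun j => iff_false_intro (iffF j (fz j) ez).2
    · exact fun j => (iffF j (fz j) ez).1
  · exact ⟨ey, ez⟩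
  · refine absurd (digraphHasInducedCopy_of_arms (H := D3Rel n) hE hy hz hyz nexy nexz dy dyz dz
      ?_ ?_ ?_ ?_ ?_ ?_ ?_ ?_ ?_) h2.2.2 <;>
      simp only [D3Rel, implies_true, not_false_eq_true]
    · exact fun j => iff_false_intro (iffF j (fy j) ey).2
    · exact fun j => (iffF j (fy j) ey).1
    · exact fun j => iff_false_intro (iffF j (fz j) ez).2
    · exact fun j => (iffF j (fz j) ez).1

end DirectedForbidden

/-! ## Vertices attached to the middle of a long induced path -/

section Arms

variable {V : Type} {G : SimpleGraph V} {n L : ℕ} {p : ℕ → V} {x : V}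

theorem IndSeq.far (hp : IndSeq G p (L + 1)) {i j : ℕ} (hi : i ≤ L) (hj : j ≤ L)
    (h : i + 1 < j ∨ j + 1 < i) : p i ≠ p j ∧ ¬ G.Adj (p i) (p j) := by
  refine ⟨hp.ne (by omega) (by omega) (by omega), ?_⟩
  rw [hp.adj_iff (by omega) (by omega)]
  omega

theorem IndSeq.next (hp : IndSeq G p (L + 1)) {i j : ℕ} (hi : i ≤ L) (hj : j ≤ L)
    (h : i + 1 = j ∨ j + 1 = i) : G.Adj (p i) (p j) :=
  (hp.adj_iff (by omega) (by omega)).2 h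

theorem IndSeq.armL (hp : IndSeq G p (L + 1)) {l : ℕ} (hl : l ≤ L) (hn : n ≤ l + 1) :
    IndSeq G (armL p l) n := by
  intro i j hij hj
  refine ⟨hp.ne (by omega) (by omega) (by omega), ?_⟩
  rw [_root_.armL, _root_.armL, hp.adj_iff (by omega) (by omega)]
  omega

theorem IndSeq.armR (hp : IndSeq G p (L + 1)) {r : ℕ} (hr : r + n ≤ L + 1) :
    IndSeq G (armR p r) n := by
  intro i j hij hj
  refine ⟨hp.ne (by omega) (by omega) (by omega), ?_⟩
  rw [_root_.armR, _root_.armR, hp.adj_iff (by omega) (by omega)]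
  omega

theorem IndSeq.arms_apart (hp : IndSeq G p (L + 1)) {l r : ℕ} (hlr : l + 1 < r)
    (hr : r + n ≤ L + 1) : Apart G (_root_.armL p l) (_root_.armR p r) n :=
  fun i hi j hj => hp.far (by omega) (by omega) (by omega)

theorem IndSeq.arms_link (hp : IndSeq G p (L + 1)) {l r : ℕ} (hlr : r = l + 1)
    (hl : n ≤ l + 1) (hr : r + n ≤ L + 1) :
    Link G (_root_.armL p l) (_root_.armR p r) n := by
  intro i hi j hj
  refine ⟨hp.ne (by omega) (by omega) (by omega), ?_⟩
  rw [_root_.armL, _root_.armR, hp.adj_iff (by omega) (by omega)]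
  omega

theorem only_armL {l : ℕ} (hn : n ≤ l + 1) (ha : G.Adj x (p l))
    (h : ∀ j < l, x ≠ p j ∧ ¬ G.Adj x (p j)) : Only G x (armL p l) n := by
  intro i hi
  cases i with
  | zero => simpa [armL] using ⟨ha.ne, ha⟩
  | succ i => simpa [armL] using h (l - (i + 1)) (by omega)

theorem only_armR {r : ℕ} (hn : r + n ≤ L + 1) (ha : G.Adj x (p r))
    (h : ∀ j, r < j → j ≤ L → x ≠ p j ∧ ¬ G.Adj x (p j)) : Only G x (armR p r) n := by
  intro i hi
  cases i with
  | zero => simpa [armR] using ⟨ha.ne, ha⟩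
  | succ i => simpa [armR] using h (r + (i + 1)) (by omega) (by omega)

theorem off_armL {l : ℕ} (h : ∀ j ≤ l, x ≠ p j ∧ ¬ G.Adj x (p j)) : Off G x (armL p l) n :=
  fun _ _ => h _ (by omega)

theorem off_armR {r : ℕ} (hn : r + n ≤ L + 1)
    (h : ∀ j, r ≤ j → j ≤ L → x ≠ p j ∧ ¬ G.Adj x (p j)) : Off G x (armR p r) n :=
  fun _ _ => h _ (by omega) (by omega)

theorem IndSeq.onlyL (hp : IndSeq G p (L + 1)) {c l : ℕ} (hc : c = l + 1) (hcL : c ≤ L)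
    (hn : n ≤ l + 1) : Only G (p c) (_root_.armL p l) n :=
  only_armL hn (hp.next hcL (by omega) (by omega))
    fun j hj => hp.far (by omega) (by omega) (by omega)

theorem IndSeq.onlyR (hp : IndSeq G p (L + 1)) {c r : ℕ} (hc : r = c + 1)
    (hn : r + n ≤ L + 1) (hr : r ≤ L) : Only G (p c) (_root_.armR p r) n :=
  only_armR hn (hp.next (by omega) (by omega) (by omega))
    fun j hj hj' => hp.far (by omega) (by omega) (by omega)

theorem IndSeq.offL (hp : IndSeq G p (L + 1)) {c l : ℕ} (hc : l + 1 < c) (hcL : c ≤ L) :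
    Off G (p c) (_root_.armL p l) n :=
  off_armL fun j hj => hp.far (by omega) (by omega) (by omega)

theorem IndSeq.offR (hp : IndSeq G p (L + 1)) {c r : ℕ} (hc : c + 1 < r) (hr : r + n ≤ L + 1) :
    Off G (p c) (_root_.armR p r) n :=
  off_armR hr fun j hj hj' => hp.far (by omega) (by omega) (by omega)

end Arms

/-- The first and last neighbours of `x` on the induced path `p 0, …, p L` are `p l` and `p r`,
these are distinct, and they are far from both ends of the path. -/
structure Span {V : Type} (G : SimpleGraph V) (p : ℕ → V) (L n : ℕ) (x : V) (l r : ℕ) : Prop where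
  hl : n + 1 ≤ l
  hlr : l < r
  hr : r + n + 1 ≤ L
  al : G.Adj x (p l)
  ar : G.Adj x (p r)
  lo : ∀ j < l, x ≠ p j ∧ ¬ G.Adj x (p j)
  hi : ∀ j, r < j → j ≤ L → x ≠ p j ∧ ¬ G.Adj x (p j)

namespace Span

variable {V : Type} {G : SimpleGraph V} {n L : ℕ} {p : ℕ → V} {x y : V} {l r l' r' : ℕ}

theorem of_path (hp : IndSeq G p (L + 1)) {i : ℕ} (hi : n + 2 ≤ i) (hi' : i + n + 2 ≤ L) :
    Span G p L n (p i) (i - 1) (i + 1) where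
  hl := by omega
  hlr := by omega
  hr := by omega
  al := hp.next (by omega) (by omega) (by omega)
  ar := hp.next (by omega) (by omega) (by omega)
  lo := fun j hj => hp.far (by omega) (by omega) (by omega)
  hi := fun j hj hj' => hp.far (by omega) (by omega) (by omega)

theorem unique (h : Span G p L n x l r) (h' : Span G p L n x l' r') : l = l' ∧ r = r' := by
  have h1 : ¬ l < l' := fun hlt => (h'.lo l hlt).2 h.al
  have h2 : ¬ l' < l := fun hlt => (h.lo l' hlt).2 h'.al
  have h3 : ¬ r < r' := fun hlt => (h.hi r' hlt (by have := h'.hr; omega)).2 h'.ar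
  have h4 : ¬ r' < r := fun hlt => (h'.hi r hlt (by have := h.hr; omega)).2 h.ar
  omega

theorem onlyL (h : Span G p L n x l r) : Only G x (armL p l) n :=
  only_armL (by have := h.hl; omega) h.al h.lo

theorem onlyR (h : Span G p L n x l r) : Only G x (armR p r) n :=
  only_armR (by have := h.hr; omega) h.ar h.hi

theorem offL (h : Span G p L n x l r) (hl : l' < l) : Off G x (armL p l') n :=
  off_armL fun j hj => h.lo j (by omega)

theorem offR (h : Span G p L n x l r) (hr : r < r') (hr' : r' + n ≤ L + 1) :
    Off G x (armR p r') n :=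
  off_armR hr' fun j hj hj' => h.hi j (by omega) hj'


theorem indL (h : Span G p L n x l r) (hp : IndSeq G p (L + 1)) : IndSeq G (armL p l) n :=
  hp.armL (by have := h.hr; have := h.hlr; omega) (by have := h.hl; omega)

theorem indR (h : Span G p L n x l r) (hp : IndSeq G p (L + 1)) : IndSeq G (armR p r) n :=
  hp.armR (by have := h.hr; omega)

/-- A vertex attached to the middle of the path has at least two neighbours on it. -/
theorem of_extremes (hA : ArmFree n G) (hp : IndSeq G p (L + 1)) (hl : n + 1 ≤ l) (hlr : l ≤ r)
    (hr : r + n + 1 ≤ L) (al : G.Adj x (p l)) (ar : G.Adj x (p r))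
    (lo : ∀ j < l, x ≠ p j ∧ ¬ G.Adj x (p j))
    (hi : ∀ j, r < j → j ≤ L → x ≠ p j ∧ ¬ G.Adj x (p j)) : Span G p L n x l r := by
  refine ⟨hl, ?_, hr, al, ar, lo, hi⟩
  rcases hlr.lt_or_eq with h | rfl
  · exact h
  exfalso
  refine hA.noF1 (x₁ := p l) (x₂ := x) (hp.armL (l := l - 1) (by omega) (by omega))
    (hp.armR (r := l + 1) (by omega)) (hp.arms_apart (by omega) (by omega))
    (hp.onlyL (by omega) (by omega) (by omega)) (hp.onlyR (by omega) (by omega) (by omega))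
    (off_armL fun j hj => lo j (by omega))
    (off_armR (by omega) fun j hj hj' => hi j (by omega) hj') al.symm

theorem not_adj_inner (h : Span G p L n x l r) (hA : ArmFree n G) (hp : IndSeq G p (L + 1))
    {c : ℕ} (hc : l + 2 ≤ c) (hc' : c + 2 ≤ r) : ¬ G.Adj x (p c) := by
  intro ha
  have := h.hr
  exact hA.noF1 (h.indL hp) (h.indR hp) (hp.arms_apart (by omega) (by omega)) h.onlyL h.onlyR
    (hp.offL (by omega) (by omega)) (hp.offR (by omega) (by omega)) ha

theorem apart_cons (h : Span G p L n x l r) (hp : IndSeq G p (L + 1)) (hl' : l' < l) :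
    Apart G (armL p l') (seqCons x (armR p r)) n := by
  have := h.hr
  have := h.hlr
  exact (hp.arms_apart (by omega) (by omega)).cons (h.offL hl')

theorem link_cons (h : Span G p L n x l r) (hp : IndSeq G p (L + 1)) (hlr : l + 2 ≤ r) :
    Link G (armL p l) (seqCons x (armR p r)) n := by
  have := h.hr
  exact (hp.arms_apart (by omega) (by omega)).consLink h.onlyL

theorem ind_cons (h : Span G p L n x l r) (hp : IndSeq G p (L + 1)) :
    IndSeq G (seqCons x (armR p r)) n := (h.indR hp).cons h.onlyR

theorem ne_path (h : Span G p L n x l r) (hp : IndSeq G p (L + 1)) {c : ℕ} (hc : c ≤ L)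
    (h' : ¬ (l + 1 = c ∧ r = l + 2)) : x ≠ p c := by
  rintro rfl
  have hr := h.hr
  have hlr := h.hlr
  have h1 := (hp.adj_iff (by omega) (by omega)).1 h.al
  have h2 := (hp.adj_iff (by omega) (by omega)).1 h.ar
  omega

theorem adj_succ (h : Span G p L n x l r) (hA : ArmFree n G) (hp : IndSeq G p (L + 1))
    (hlr : l + 3 ≤ r) : G.Adj x (p (l + 1)) := by
  by_contra hna
  have hl := h.hl
  have hr := h.hr
  exact hA.noF1 (x₁ := p l) (x₂ := p (l + 1)) (hp.armL (l := l - 1) (by omega) (by omega))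
    (h.ind_cons hp) (h.apart_cons hp (by omega)) (hp.onlyL (by omega) (by omega) (by omega))
    (Only.cons h.al.symm (hp.offR (by omega) (by omega))) (hp.offL (by omega) (by omega))
    (Off.cons (h.ne_path hp (by omega) (by omega)).symm (fun h' => hna h'.symm)
      (hp.offR (by omega) (by omega)))
    (hp.next (by omega) (by omega) (by omega))

theorem le_add_three (h : Span G p L n x l r) (hA : ArmFree n G) (hp : IndSeq G p (L + 1)) :
    r ≤ l + 3 := by
  by_contra hcon
  have hl := h.hl
  have hr := h.hr
  exact hA.noF2 (x₁ := p (l + 1)) (x₂ := p (l + 2)) (h.indL hp) (h.ind_cons hp)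
    (h.link_cons hp (by omega)) (hp.onlyL (by omega) (by omega) (by omega))
    (Only.cons (h.adj_succ hA hp (by omega)).symm (hp.offR (by omega) (by omega)))
    (hp.offL (by omega) (by omega))
    (Off.cons (h.ne_path hp (by omega) (by omega)).symm
      (fun h' => h.not_adj_inner hA hp (by omega) (by omega) h'.symm)
      (hp.offR (by omega) (by omega)))
    (hp.next (by omega) (by omega) (by omega))

theorem no_outside_neighbour (h : Span G p L n x l r) (hA : ArmFree n G) (hp : IndSeq G p (L + 1))
    {u : V} (hu : ∀ j ≤ L, u ≠ p j ∧ ¬ G.Adj u (p j)) (hux : G.Adj x u) : False := by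
  have hl := h.hl
  have hr := h.hr
  have hlr := h.hlr
  have o1 : Off G u (armL p l) n := off_armL fun j hj => hu j (by omega)
  have o2 : Off G u (armR p r) n := off_armR (by omega) fun j hj hj' => hu j hj'
  by_cases hc : r = l + 1
  · exact hA.noF2 (h.indL hp) (h.indR hp) (hp.arms_link hc (by omega) (by omega)) h.onlyL h.onlyR
      o1 o2 hux
  · exact hA.noF1 (h.indL hp) (h.indR hp) (hp.arms_apart (by omega) (by omega)) h.onlyL h.onlyR
      o1 o2 hux

theorem adj_of_left_eq_of_lt (h : Span G p L n x l r) (h' : Span G p L n y l r')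
    (hA : ArmFree n G) (hp : IndSeq G p (L + 1)) (hne : x ≠ y) (hr : r < r') : G.Adj x y := by
  by_contra hna
  have hl := h.hl
  have hlr := h.hlr
  have hr' := h'.hr
  exact hA.noF1 (x₁ := p l) (x₂ := x) (hp.armL (l := l - 1) (by omega) (by omega))
    (h'.ind_cons hp) (h'.apart_cons hp (by omega)) (hp.onlyL (by omega) (by omega) (by omega))
    (Only.cons h'.al.symm (hp.offR (by omega) (by omega))) (h.offL (by omega))
    (Off.cons hne hna (h.offR hr (by omega))) h.al.symm

theorem adj_of_left_eq (h : Span G p L n x l r) (h' : Span G p L n y l r')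
    (hA : ArmFree n G) (hp : IndSeq G p (L + 1)) (hne : x ≠ y) : G.Adj x y := by
  rcases lt_trichotomy r r' with hr | rfl | hr
  · exact h.adj_of_left_eq_of_lt h' hA hp hne hr
  · have hl := h.hl
    have hr := h.hr
    have hlr := h.hlr
    by_cases hc : r = l + 1
    · exact hA.noF4 (h.indL hp) (h.indR hp) (hp.arms_link hc (by omega) (by omega)) h.onlyL h.onlyR
        h'.onlyL h'.onlyR hne
    · exact hA.noF3 (h.indL hp) (h.indR hp) (hp.arms_apart (by omega) (by omega)) h.onlyL h.onlyR
        h'.onlyL h'.onlyR hne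
  · exact (h'.adj_of_left_eq_of_lt h hA hp hne.symm hr).symm

theorem ind_cons_left (h : Span G p L n x l r) (hp : IndSeq G p (L + 1)) :
    IndSeq G (seqCons x (armL p l)) n := (h.indL hp).cons h.onlyL

theorem apart_cons_left (h : Span G p L n x l r) (hp : IndSeq G p (L + 1)) (hr : r < r')
    (hr' : r' + n ≤ L + 1) : Apart G (seqCons x (armL p l)) (armR p r') n := by
  have := h.hlr
  exact ((hp.arms_apart (by omega) (by omega)).symm.cons (h.offR hr hr')).symm

theorem link_cons_left (h : Span G p L n x l r) (hp : IndSeq G p (L + 1)) (hlr : l + 2 ≤ r) :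
    Link G (seqCons x (armL p l)) (armR p r) n := by
  have := h.hr
  exact ((hp.arms_apart (by omega) (by omega)).symm.consLink h.onlyR).symm

theorem adj_of_right_eq_of_lt (h : Span G p L n x l r) (h' : Span G p L n y l' r)
    (hA : ArmFree n G) (hp : IndSeq G p (L + 1)) (hne : x ≠ y) (hl : l < l') : G.Adj x y := by
  by_contra hna
  have hr := h.hr
  have hlr := h'.hlr
  exact hA.noF1 (x₁ := p r) (x₂ := y) (h.ind_cons_left hp) (hp.armR (r := r + 1) (by omega))
    (h.apart_cons_left hp (by omega) (by omega))
    (Only.cons h.ar.symm (hp.offL (by omega) (by omega)))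
    (hp.onlyR (by omega) (by omega) (by omega))
    (Off.cons hne.symm (fun h => hna h.symm) (h'.offL hl)) (h'.offR (by omega) (by omega))
    h'.ar.symm

theorem adj_of_right_eq (h : Span G p L n x l r) (h' : Span G p L n y l' r)
    (hA : ArmFree n G) (hp : IndSeq G p (L + 1)) (hne : x ≠ y) : G.Adj x y := by
  rcases lt_trichotomy l l' with hl | rfl | hl
  · exact h.adj_of_right_eq_of_lt h' hA hp hne hl
  · exact h.adj_of_left_eq h' hA hp hne
  · exact (h'.adj_of_right_eq_of_lt h hA hp hne.symm hl).symm

theorem not_nested (h : Span G p L n x l r) (h' : Span G p L n y l' r')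
    (hA : ArmFree n G) (hp : IndSeq G p (L + 1)) (hl : l < l') : r ≤ r' := by
  by_contra hr
  have h1 := h.hr
  have h2 := h.hl
  have h3 := h'.hlr
  have h4 := h.le_add_three hA hp
  by_cases ha : G.Adj x y
  · exact hA.noF1 (h.indL hp) (h.indR hp) (hp.arms_apart (by omega) (by omega)) h.onlyL h.onlyR
      (h'.offL hl) (h'.offR (by omega) (by omega)) ha
  · have hxy : y ≠ x := by
      rintro rfl
      have := (h.unique h').1
      omega
    obtain rfl : l' = l + 1 := by omega
    exact hA.noF2 (x₁ := p (l + 1)) (x₂ := y) (h.indL hp) (h.ind_cons hp)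
      (h.link_cons hp (by omega)) (hp.onlyL (by omega) (by omega) (by omega))
      (Only.cons (h.adj_succ hA hp (by omega)).symm (hp.offR (by omega) (by omega)))
      (h'.offL hl) (Off.cons hxy (fun h => ha h.symm) (h'.offR (by omega) (by omega))) h'.al.symm

theorem strict_of_not_adj (h : Span G p L n x l r) (h' : Span G p L n y l' r')
    (hA : ArmFree n G) (hp : IndSeq G p (L + 1)) (hne : x ≠ y) (hna : ¬ G.Adj x y) :
    (l < l' ∧ r < r') ∨ (l' < l ∧ r' < r) := by
  rcases lt_trichotomy l l' with hl | rfl | hl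
  · refine Or.inl ⟨hl, (h.not_nested h' hA hp hl).lt_of_ne ?_⟩
    rintro rfl
    exact hna (h.adj_of_right_eq h' hA hp hne)
  · exact absurd (h.adj_of_left_eq h' hA hp hne) hna
  · refine Or.inr ⟨hl, (h'.not_nested h hA hp hl).lt_of_ne ?_⟩
    rintro rfl
    exact hna (h.adj_of_right_eq h' hA hp hne)

/-- Adjacent attached vertices have overlapping or consecutive spans. -/
theorem close (h : Span G p L n x l r) (h' : Span G p L n y l' r')
    (hA : ArmFree n G) (hp : IndSeq G p (L + 1)) (ha : G.Adj x y) : l' ≤ r + 1 := by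
  by_contra hcon
  have h1 := h.hr
  have h2 := h.hl
  have h3 := h.hlr
  have h4 := h'.hr
  have h5 := h'.hlr
  by_cases hc : r = l + 1
  · subst hc
    have h6 : Off G x (armR p r') n := h.offR (by omega) (by omega)
    have o2 := h.hi (l + 2) (by omega) (by omega)
    have o1 := h'.lo (l + 1) (by omega)
    have o3 := h'.lo (l + 2) (by omega)
    exact hA.noF2 (x₁ := p (l + 1)) (x₂ := p (l + 2)) (h.indL hp)
      ((h'.ind_cons hp).cons (Only.cons ha h6))
      ((h'.apart_cons hp (by omega)).consLink h.onlyL) (hp.onlyL (by omega) (by omega) (by omega))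
      (Only.cons h.ar.symm (Off.cons o1.1.symm (fun h => o1.2 h.symm)
        (hp.offR (by omega) (by omega))))
      (hp.offL (by omega) (by omega))
      (Off.cons o2.1.symm (fun h => o2.2 h.symm) (Off.cons o3.1.symm (fun h => o3.2 h.symm)
        (hp.offR (by omega) (by omega))))
      (hp.next (by omega) (by omega) (by omega))
  · have o1 := h'.lo r (by omega)
    exact hA.noF1 (x₁ := x) (x₂ := p r) (h.indL hp) (h'.ind_cons hp)
      (h'.apart_cons hp (by omega)) h.onlyL (Only.cons ha (h.offR (by omega) (by omega)))
      (hp.offL (by omega) (by omega))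
      (Off.cons o1.1.symm (fun h => o1.2 h.symm) (hp.offR (by omega) (by omega))) h.ar

end Span

/-! ## Vertices not attached to the middle of the path are close to its ends -/

section Descent

variable {V : Type} {G : SimpleGraph V}

theorem IndSeq.reverse_append {y z : ℕ → V} {m k : ℕ} (hy : IndSeq G y m) (hz : IndSeq G z k)
    (hyz : ∀ i < m, ∀ j < k, y i ≠ z j ∧ (G.Adj (y i) (z j) ↔ i = 0 ∧ j = 0)) :
    IndSeq G (fun t => if t < m then y (m - 1 - t) else z (t - m)) (m + k) := by
  intro i j hij hj
  by_cases hjm : j < m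
  · have him : i < m := by omega
    simp only [hjm, him, if_true]
    refine ⟨hy.ne (by omega) (by omega) (by omega), ?_⟩
    rw [hy.adj_iff (by omega) (by omega)]
    omega
  · by_cases him : i < m
    · simp only [hjm, him, if_true, if_false]
      have := hyz (m - 1 - i) (by omega) (j - m) (by omega)
      refine ⟨this.1, ?_⟩
      rw [this.2]
      omega
    · simp only [hjm, him, if_false]
      refine ⟨hz.ne (by omega) (by omega) (by omega), ?_⟩
      rw [hz.adj_iff (by omega) (by omega)]
      omega

variable [Fintype V] [DecidableEq V]

theorem exists_descent {X : Finset V} (k : ℕ) {v : V} (hv : v ∈ layerFinset G X k) :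
    ∃ w : ℕ → V, w k = v ∧ (∀ i ≤ k, w i ∈ layerFinset G X i) ∧ ∀ i < k, G.Adj (w i) (w (i + 1)) := by
  induction k generalizing v with
  | zero =>
    refine ⟨fun _ => v, rfl, fun i hi => ?_, fun i hi => absurd hi (by omega)⟩
    rwa [Nat.le_zero.1 hi]
  | succ k ih =>
    obtain ⟨u, hu, huv⟩ := exists_adj_of_mem_layer hv
    obtain ⟨w, hw, hlay, hadj⟩ := ih hu
    refine ⟨fun i => if i = k + 1 then v else w i, by simp, fun i hi => ?_, fun i hi => ?_⟩
    · by_cases h : i = k + 1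
      · subst h; simpa using hv
      · simpa [h] using hlay i (by omega)
    · have h1 : i ≠ k + 1 := by omega
      by_cases h : i = k
      · subst h; simpa [hw] using huv
      · simpa [h1, h] using hadj i (by omega)

theorem not_adj_of_layer {X : Finset V} {i j : ℕ} (hij : i + 1 < j) {u v : V}
    (hu : u ∈ layerFinset G X i) (hv : v ∈ layerFinset G X j) : ¬ G.Adj u v := by
  intro h
  obtain ⟨j, rfl⟩ : ∃ k, j = k + 1 := ⟨j - 1, by omega⟩
  refine (Finset.mem_sdiff.1 hv).2 (ballFinset_mono (i := i + 1) (by omega) ?_)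
  exact mem_ballFinset_succ.2 (Or.inr ⟨u, layerFinset_subset_ball i hu, h⟩)

theorem ne_of_layer {X : Finset V} {i j : ℕ} (hij : i ≠ j) {u v : V}
    (hu : u ∈ layerFinset G X i) (hv : v ∈ layerFinset G X j) : u ≠ v := by
  rintro rfl
  exact Finset.disjoint_left.1 (layerFinset_disjoint hij) hu hv

theorem exists_layer_of_connected (hG : G.Connected) {X : Finset V} (hX : X.Nonempty) (v : V) :
    ∃ k, v ∈ layerFinset G X k := by
  obtain ⟨x, hx⟩ := hX
  have key : ∀ {u w : V}, G.Walk u w → (∃ k, u ∈ ballFinset G X k) →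
      ∃ k, w ∈ ballFinset G X k := by
    intro u w q
    induction q with
    | nil => exact id
    | cons h _ ih =>
      rintro ⟨k, hk⟩
      exact ih ⟨k + 1, mem_ballFinset_succ.2 (Or.inr ⟨_, hk, h⟩)⟩
  obtain ⟨q⟩ := hG.preconnected x v
  obtain ⟨k, hk⟩ := key q ⟨0, hx⟩
  rw [ballFinset_eq_biUnion] at hk
  obtain ⟨i, -, hi⟩ := Finset.mem_biUnion.1 hk
  exact ⟨i, hi⟩

end Descent

section Depth

variable {V : Type} {G : SimpleGraph V} {n L : ℕ} {p : ℕ → V}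

/-- The vertices of the path `p 0, …, p L` within distance `n` along the path of an end. -/
def endSet [DecidableEq V] (p : ℕ → V) (L n : ℕ) : Finset V :=
  ((Finset.range (L + 1)).filter (fun j => j ≤ n ∨ L ≤ j + n)).image p

theorem mem_endSet [DecidableEq V] {j : ℕ} (hj : j ≤ L) (h : j ≤ n ∨ L ≤ j + n) :
    p j ∈ endSet p L n :=
  Finset.mem_image_of_mem _ (by simp; omega)

theorem IndepLE.endSet [DecidableEq V] (hp : IndSeq G p (L + 1)) :
    IndepLE G (endSet p L n) (2 * (n / 2 + 1)) := by
  intro I hI hind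
  set J := (Finset.range (L + 1)).filter (fun j => (j ≤ n ∨ L ≤ j + n) ∧ p j ∈ I) with hJ
  have h1 : I.card ≤ J.card := by
    have : I ⊆ J.image p := by
      intro x hx
      obtain ⟨j, hj, rfl⟩ := Finset.mem_image.1 (hI hx)
      rw [Finset.mem_filter] at hj
      exact Finset.mem_image_of_mem _ (Finset.mem_filter.2 ⟨hj.1, hj.2, hx⟩)
    exact (Finset.card_le_card this).trans Finset.card_image_le
  have h2 : J.card ≤ (Finset.range (2 * (n / 2 + 1))).card := by
    refine Finset.card_le_card_of_injOn
      (fun j => if j ≤ n then j / 2 else n / 2 + 1 + (L - j) / 2) ?_ ?_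
    · intro j hj
      simp only [hJ, Finset.coe_filter, Finset.mem_range, Set.mem_ofPred_eq] at hj
      simp only [Finset.coe_range, Set.mem_Iio]
      split_ifs <;> omega
    · intro i hi j hj hij
      simp only [hJ, Finset.coe_filter, Finset.mem_range, Set.mem_ofPred_eq] at hi hj hij
      have := hind _ hi.2.2 _ hj.2.2
      rw [hp.adj_iff hi.1 hj.1] at this
      split_ifs at hij <;> omega
  simpa using h1.trans h2

theorem exists_extremes {c : V} {j : ℕ} (hj : j ≤ L) (ha : G.Adj c (p j)) :
    ∃ a b, a ≤ j ∧ j ≤ b ∧ b ≤ L ∧ G.Adj c (p a) ∧ G.Adj c (p b) ∧ (∀ i < a, ¬ G.Adj c (p i)) ∧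
      ∀ i, b < i → i ≤ L → ¬ G.Adj c (p i) := by
  classical
  have hex : ∃ i, G.Adj c (p i) := ⟨j, ha⟩
  refine ⟨Nat.find hex, Nat.findGreatest (fun i => G.Adj c (p i)) L, Nat.find_min' hex ha,
    Nat.le_findGreatest hj ha, Nat.findGreatest_le _, Nat.find_spec hex,
    Nat.findGreatest_spec (P := fun i => G.Adj c (p i)) hj ha, fun i hi => Nat.find_min hex hi,
    fun i hi hi' => Nat.findGreatest_is_greatest hi hi'⟩

/-- A sequence of indices, each close to the previous one, contains a long sparse subset. -/
theorem exists_sparse_subset {S : ℕ → Prop} {a b : ℕ} (ha : S a)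
    (hstep : ∀ s, S s → s + 2 ≤ b → ∃ s', S s' ∧ s + 2 ≤ s' ∧ s' ≤ s + n) (m : ℕ)
    (hm : a + (m - 1) * n + 2 ≤ b) :
    ∃ J : Finset ℕ, J.card = m + 1 ∧ (∀ j ∈ J, S j) ∧ (∀ i ∈ J, ∀ j ∈ J, i < j → i + 2 ≤ j) ∧
      ∃ s ∈ J, s ≤ a + m * n ∧ ∀ j ∈ J, j ≤ s := by
  induction m with
  | zero => exact ⟨{a}, by simp, by simpa using ha, by simp, a, by simp⟩
  | succ m ih =>
    have hmul : (m + 1) * n = m * n + n := by ring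
    have hm1 : (m - 1) * n ≤ m * n := Nat.mul_le_mul_right _ (by omega)
    simp only [Nat.add_sub_cancel] at hm
    obtain ⟨J, hJ, hS, hsp, s, hs, hsle, hmax⟩ := ih (by omega)
    obtain ⟨s', hs', h1, h2⟩ := hstep s (hS s hs) (by omega)
    have hnot : s' ∉ J := fun h => by have := hmax s' h; omega
    refine ⟨insert s' J, by rw [Finset.card_insert_of_notMem hnot, hJ], ?_, ?_, s', by simp,
      by omega, ?_⟩
    · intro j hj
      rcases Finset.mem_insert.1 hj with rfl | hj
      exacts [hs', hS j hj]
    · intro i hi j hj hij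
      rw [Finset.mem_insert] at hi hj
      rcases hi with rfl | hi
      · rcases hj with rfl | hj
        · omega
        · have := hmax j hj
          omega
      · rcases hj with rfl | hj
        · have := hmax i hi
          omega
        · exact hsp i hi j hj hij
    · intro j hj
      rcases Finset.mem_insert.1 hj with rfl | hj
      · omega
      · have := hmax j hj; omega

/-- A long induced path hanging off `p` near its end cannot exist: here `q 0` is its attachment
vertex. -/
theorem pendant_length_le (hn : 3 ≤ n) (hA : ArmFree n G) (hstar : ¬ HasInducedCopyG (StarG n) G)
    (hp : IndSeq G p (L + 1)) (hlong : ∀ q m, IndSeq G q m → m ≤ L + 1)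
    (hL : 2 * n + 1 ≤ L) (hL' : n * n ≤ L + n + 1) {q : ℕ → V} {k : ℕ} (hk : 2 ≤ k)
    (hq : IndSeq G q k) (hq0 : ∀ j ≤ L, q 0 ≠ p j)
    (hoff : ∀ i, 0 < i → i < k → ∀ j ≤ L, q i ≠ p j ∧ ¬ G.Adj (q i) (p j))
    {s₀ : ℕ} (hs₀ : s₀ ≤ L) (hs₀' : s₀ ≤ n ∨ L ≤ s₀ + n) (has : G.Adj (q 0) (p s₀)) :
    k ≤ n + 1 := by
  by_contra hcon
  obtain ⟨a, b, haj, hjb, hbL, haa, hab, hmin, hmax⟩ := exists_extremes hs₀ has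
  have hlink : ∀ {z : ℕ → V} {m : ℕ} (f : ℕ → ℕ), (∀ j, z j = p (f j)) → (∀ j < m, f j ≤ L) →
      (∀ j < m, (G.Adj (q 0) (p (f j)) ↔ j = 0)) →
      ∀ i < k, ∀ j < m, q i ≠ z j ∧ (G.Adj (q i) (z j) ↔ i = 0 ∧ j = 0) := by
    intro z m f hz hf h0 i hi j hj
    rw [hz]
    rcases Nat.eq_zero_or_pos i with rfl | hi0
    · exact ⟨hq0 _ (hf j hj), by simpa using h0 j hj⟩
    · have := hoff i hi0 hi _ (hf j hj)
      refine ⟨this.1, iff_of_false this.2 (by omega)⟩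
  have hkb : k ≤ b := by
    have hz := hp.armR (n := L - b + 1) (r := b) (by omega)
    have := hlong _ _ (hq.reverse_append hz (hlink (fun j => b + j) (fun _ => rfl)
      (fun j hj => by omega) (fun j hj => by
        rcases Nat.eq_zero_or_pos j with rfl | hj0
        · simpa using hab
        · exact iff_of_false (hmax _ (by omega) (by omega)) (by omega))))
    omega
  have hka : k + a ≤ L := by
    have hz := hp.armL (n := a + 1) (l := a) (by omega) (by omega)
    have := hlong _ _ (hq.reverse_append hz (hlink (fun j => a - j) (fun _ => rfl)
      (fun j hj => by omega) (fun j hj => by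
        rcases Nat.eq_zero_or_pos j with rfl | hj0
        · simpa using haa
        · exact iff_of_false (hmin _ (by omega)) (by omega))))
    omega
  have hz : IndSeq G (fun i => q (i + 1)) n := by
    intro i j hij hj
    have := hq (i + 1) (j + 1) (by omega) (by omega)
    exact ⟨this.1, by rw [this.2]; omega⟩
  have h0z : Only G (q 0) (fun i => q (i + 1)) n := by
    intro i hi
    refine ⟨hq.ne (by omega) (by omega) (by omega), ?_⟩
    rw [hq.adj_iff (by omega) (by omega)]
    omega
  have hpz : ∀ j ≤ L, Off G (p j) (fun i => q (i + 1)) n := by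
    intro j hj i hi
    have := hoff (i + 1) (by omega) (by omega) j hj
    exact ⟨this.1.symm, fun h => this.2 h.symm⟩
  -- an arm of `n` path vertices attached to `q 0` only through its first vertex
  have harm : ∀ (f : ℕ → ℕ), (∀ j < n, f j ≤ L) → IndSeq G (fun j => p (f j)) n →
      (∀ j < n, (G.Adj (q 0) (p (f j)) ↔ j = 0)) → ∀ t ≤ L, G.Adj (q 0) (p t) →
      Off G (p t) (fun j => p (f j)) n → False := by
    intro f hf hind h0 t ht hadj hofft
    refine hA.noF1 (x₁ := q 0) (x₂ := p t) hind hz ?_ ?_ h0z hofft (hpz t ht) hadj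
    · exact fun i hi j hj => (hpz _ (hf i hi)) j hj
    · exact fun j hj => ⟨hq0 _ (hf j hj), h0 j hj⟩
  have ha2 : a + 2 ≤ n := by
    by_contra han
    have hb : b ≤ a + 1 := by
      by_contra hb
      refine harm (fun j => a - j) (fun j hj => by omega) (hp.armL (by omega) (by omega)) ?_ b hbL hab
        (hp.offL (by omega) hbL)
      intro j hj
      rcases Nat.eq_zero_or_pos j with rfl | hj0
      · simpa using haa
      · exact iff_of_false (hmin _ (by omega)) (by omega)
    omega
  have hb2 : L + 2 ≤ b + n := by
    by_contra hbn
    have hb : b ≤ a + 1 := by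
      by_contra hb
      refine harm (fun j => b + j) (fun j hj => by omega) (hp.armR (by omega)) ?_ a (by omega) haa
        (hp.offR (by omega) (by omega))
      intro j hj
      rcases Nat.eq_zero_or_pos j with rfl | hj0
      · simpa using hab
      · exact iff_of_false (hmax _ (by omega) (by omega)) (by omega)
    omega
  have hL3 : 3 * n ≤ L + 2 := by
    rcases Nat.lt_or_ge n 4 with h | h
    · omega
    · nlinarith
  have hnext : ∀ s, s ≤ L → G.Adj (q 0) (p s) → s < b → ∃ s', s < s' ∧ s' < s + n ∧ s' ≤ L ∧
      G.Adj (q 0) (p s') := by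
    intro s hs hadj hsb
    by_contra hno
    push Not at hno
    have hsn : s + n ≤ b := by
      by_contra h
      exact hno b hsb (by omega) hbL hab
    have hf : ∀ t ≤ L, G.Adj (q 0) (p t) → ¬ (t + 1 < s ∨ s + n < t) := by
      intro t ht hadjt hcase
      refine harm (fun j => s + j) (fun j hj => by omega) (hp.armR (by omega)) ?_ t ht hadjt ?_
      · intro j hj
        rcases Nat.eq_zero_or_pos j with rfl | hj0
        · simpa using hadj
        · exact iff_of_false (hno _ (by omega) (by omega) (by omega)) (by omega)
      · exact fun j hj => hp.far ht (by omega) (by omega)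
    have h1 := hf a (by omega) haa
    have h2 := hf b hbL hab
    have : n ≠ 3 ∨ 7 ≤ L := by omega
    have : n = 3 ∨ 3 * n < L + 3 := by
      rcases Nat.lt_or_ge n 4 with h | h
      · omega
      · right; nlinarith
    omega
  obtain ⟨J, hJ, hS, hsp, -⟩ := exists_sparse_subset (n := n)
    (S := fun s => s ≤ L ∧ G.Adj (q 0) (p s)) (a := a) (b := b) ⟨by omega, haa⟩ (by
      rintro s ⟨hsL, hs⟩ hsb
      obtain ⟨s₁, h1, h2, h3, h4⟩ := hnext s hsL hs (by omega)
      by_cases hs1 : s₁ = s + 1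
      · obtain ⟨s₂, h5, h6, h7, h8⟩ := hnext s₁ h3 h4 (by omega)
        exact ⟨s₂, ⟨h7, h8⟩, by omega, by omega⟩
      · exact ⟨s₁, ⟨h3, h4⟩, by omega, by omega⟩) (n - 2) (by
      obtain ⟨m, rfl⟩ : ∃ m, n = m + 3 := ⟨n - 3, by omega⟩
      have : m + 3 - 2 - 1 = m := by omega
      rw [this]
      nlinarith)
  classical
  have hinj : Set.InjOn p J := by
    intro i hi j hj hij
    by_contra hne
    exact hp.ne (by have := (hS i hi).1; omega) (by have := (hS j hj).1; omega) hne hij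
  have hnot : q 1 ∉ J.image p := by
    intro h
    obtain ⟨j, hj, hj'⟩ := Finset.mem_image.1 h
    exact (hoff 1 (by omega) (by omega) j (hS j hj).1).1 hj'.symm
  have hcard := card_lt_of_star_free hstar (v := q 0) (I := insert (q 1) (J.image p)) (by
    intro x hx y hy
    have hq1 : ∀ j ∈ J, ¬ G.Adj (q 1) (p j) := fun j hj =>
      (hoff 1 (by omega) (by omega) j (hS j hj).1).2
    rcases Finset.mem_insert.1 hx with rfl | hx <;> rcases Finset.mem_insert.1 hy with rfl | hy
    · simp
    · obtain ⟨j, hj, rfl⟩ := Finset.mem_image.1 hy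
      exact hq1 j hj
    · obtain ⟨j, hj, rfl⟩ := Finset.mem_image.1 hx
      exact fun h => hq1 j hj h.symm
    · obtain ⟨i, hi, rfl⟩ := Finset.mem_image.1 hx
      obtain ⟨j, hj, rfl⟩ := Finset.mem_image.1 hy
      have hi' := (hS i hi).1
      have hj' := (hS j hj).1
      rw [hp.adj_iff (by omega) (by omega)]
      have h1 := hsp i hi j hj
      have h2 := hsp j hj i hi
      omega) (by
    intro x hx
    rcases Finset.mem_insert.1 hx with rfl | hx
    · exact (hq.adj_iff (by omega) (by omega)).2 (by omega)
    · obtain ⟨j, hj, rfl⟩ := Finset.mem_image.1 hx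
      exact (hS j hj).2)
  rw [Finset.card_insert_of_notMem hnot, Finset.card_image_of_injOn hinj] at hcard
  omega

/-- A vertex with a neighbour on the path is attached to its middle or close to an end. -/
theorem span_or_near_end [DecidableEq V] [Fintype V] (hA : ArmFree n G)
    (hp : IndSeq G p (L + 1)) {v : V}
    {j : ℕ} (hj : j ≤ L) (hv : v = p j ∨ G.Adj v (p j)) :
    (∃ l r, Span G p L n v l r) ∨ v ∈ endSet p L n ∨
      ∃ s ≤ L, (s ≤ n ∨ L ≤ s + n) ∧ G.Adj v (p s) := by
  by_cases hP : ∃ i ≤ L, v = p i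
  · obtain ⟨i, hi, rfl⟩ := hP
    by_cases hc : i ≤ n ∨ L ≤ i + n
    · exact Or.inr (Or.inl (mem_endSet hi hc))
    by_cases h1 : i = n + 1
    · exact Or.inr (Or.inr ⟨n, by omega, Or.inl le_rfl, hp.next hi (by omega) (by omega)⟩)
    by_cases h2 : i + n + 1 = L
    · exact Or.inr (Or.inr ⟨i + 1, by omega, Or.inr (by omega), hp.next hi (by omega) (by omega)⟩)
    exact Or.inl ⟨_, _, Span.of_path hp (i := i) (by omega) (by omega)⟩
  · push Not at hP
    have hv' := hv.resolve_left (hP j hj)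
    obtain ⟨a, b, haj, hjb, hbL, haa, hab, hmin, hmax⟩ := exists_extremes hj hv'
    by_cases h1 : a ≤ n
    · exact Or.inr (Or.inr ⟨a, by omega, Or.inl h1, haa⟩)
    by_cases h2 : L ≤ b + n
    · exact Or.inr (Or.inr ⟨b, hbL, Or.inr h2, hab⟩)
    exact Or.inl ⟨a, b, Span.of_extremes hA hp (by omega) (by omega) (by omega) haa hab
      (fun i hi => ⟨hP i (by omega), hmin i hi⟩) (fun i hi hi' => ⟨hP i hi', hmax i hi hi'⟩)⟩

theorem mem_ball_of_not_span [DecidableEq V] [Fintype V] (hn : 3 ≤ n) (hA : ArmFree n G)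
    (hstar : ¬ HasInducedCopyG (StarG n) G) (hG : G.Connected)
    (hp : IndSeq G p (L + 1)) (hlong : ∀ q m, IndSeq G q m → m ≤ L + 1)
    (hL : 2 * n + 1 ≤ L) (hL' : n * n ≤ L + n + 1) {v : V}
    (hv : ∀ l r, ¬ Span G p L n v l r) : v ∈ ballFinset G (endSet p L n) (n + 1) := by
  have hnear : ∀ {u : V} {s : ℕ}, s ≤ L → (s ≤ n ∨ L ≤ s + n) → G.Adj u (p s) →
      u ∈ ballFinset G (endSet p L n) 1 := fun hs hs' h =>
    mem_ballFinset_succ.2 (Or.inr ⟨_, mem_endSet hs hs', h.symm⟩)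
  set PF := (Finset.range (L + 1)).image p with hPF
  have hmemPF : ∀ j ≤ L, p j ∈ PF := fun j hj =>
    Finset.mem_image_of_mem _ (Finset.mem_range.2 (by omega))
  have hlay0 : ∀ j ≤ L, p j ∈ layerFinset G PF 0 := hmemPF
  obtain ⟨k, hk⟩ := exists_layer_of_connected hG (X := PF) ⟨p 0, hmemPF 0 (by omega)⟩ v
  have hclosed : (∃ j ≤ L, v = p j ∨ G.Adj v (p j)) →
      v ∈ ballFinset G (endSet p L n) (n + 1) := by
    rintro ⟨j, hj, h⟩
    rcases span_or_near_end (n := n) hA hp hj h with ⟨l, r, h⟩ | h | ⟨s, hs, hs', h⟩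
    · exact absurd h (hv l r)
    · exact ballFinset_mono (i := 0) (by omega) h
    · exact ballFinset_mono (i := 1) (by omega) (hnear hs hs' h)
  obtain ⟨w, rfl, hlay, hadj⟩ := exists_descent k hk
  rcases Nat.lt_or_ge k 2 with hk2 | hk2
  · apply hclosed
    obtain rfl | rfl : k = 0 ∨ k = 1 := by omega
    · obtain ⟨j, hj, hj'⟩ := Finset.mem_image.1 (hlay 0 le_rfl)
      exact ⟨j, by simpa [Nat.lt_succ_iff] using hj, Or.inl hj'.symm⟩
    · obtain ⟨j, hj, hj'⟩ := Finset.mem_image.1 (hlay 0 (by omega))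
      refine ⟨j, by simpa [Nat.lt_succ_iff] using hj, Or.inr ?_⟩
      rw [hj']
      exact (hadj 0 (by omega)).symm
  · have hoff : ∀ i, 2 ≤ i → i ≤ k → ∀ j ≤ L, w i ≠ p j ∧ ¬ G.Adj (w i) (p j) := by
      intro i hi hik j hj
      exact ⟨ne_of_layer (by omega) (hlay i hik) (hlay0 j hj),
        fun h => not_adj_of_layer (by omega) (hlay0 j hj)
          (hlay i hik) h.symm⟩
    have hw1 : ∀ j ≤ L, w 1 ≠ p j := fun j hj =>
      ne_of_layer (by omega) (hlay 1 (by omega)) (hlay0 j hj)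
    obtain ⟨j₀, hj₀, hj₀'⟩ := Finset.mem_image.1 (hlay 0 (by omega))
    have hadj0 : G.Adj (w 1) (p j₀) := by
      rw [hj₀']
      exact (hadj 0 (by omega)).symm
    obtain ⟨s, hs, hs', hws⟩ : ∃ s ≤ L, (s ≤ n ∨ L ≤ s + n) ∧ G.Adj (w 1) (p s) := by
      rcases span_or_near_end (n := n) hA hp (by simpa [Nat.lt_succ_iff] using hj₀)
        (Or.inr hadj0) with ⟨l, r, h⟩ | h | h
      · exact (h.no_outside_neighbour hA hp (hoff 2 le_rfl hk2) (hadj 1 (by omega))).elim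
      · obtain ⟨j, hj, hj'⟩ := Finset.mem_image.1 h
        have := Finset.mem_range.1 (Finset.mem_filter.1 hj).1
        exact absurd hj'.symm (hw1 j (by omega))
      · exact h
    have hball : ∀ i, 1 ≤ i → i ≤ k → w i ∈ ballFinset G (endSet p L n) i := by
      intro i hi
      induction i, hi using Nat.le_induction with
      | base => exact fun _ => hnear hs hs' hws
      | succ i hi ih =>
        exact fun hik => mem_ballFinset_succ.2 (Or.inr ⟨_, ih (by omega), hadj i (by omega)⟩)
    have hkn : k ≤ n + 1 := by
      refine pendant_length_le (q := fun i => w (i + 1)) hn hA hstar hp hlong hL hL' hk2 ?_ hw1 ?_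
        hs hs' hws
      · intro i j hij hj
        refine ⟨ne_of_layer (by omega) (hlay _ (by omega)) (hlay _ (by omega)), fun h => ?_, ?_⟩
        · by_contra hne
          exact not_adj_of_layer (by omega) (hlay (i + 1) (by omega)) (hlay (j + 1) (by omega)) h
        · rintro rfl
          exact hadj (i + 1) (by omega)
      · exact fun i hi hik => hoff (i + 1) (by omega) (by omega)
    exact ballFinset_mono hkn (hball k (by omega) le_rfl)

end Depth

/-! ## Turns along substituted paths -/

/-- The middle vertex of the pseudo-path `a, b, c` is a source or a sink of it. -/
def IsTurn {V : Type} (E : V → V → Prop) (a b c : V) : Prop :=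
  (E b a ∧ E b c) ∨ (E a b ∧ E c b)

/-- At `p t` the path `p` can be rerouted through two adjacent attached vertices `x`, `y` in such
a way that the rerouted part contains a turn. -/
def TurnAt {V : Type} (E : V → V → Prop) (G : SimpleGraph V) (p : ℕ → V) (L n t : ℕ) : Prop :=
  ∃ x y r₁ l₂ r, Span G p L n x t r₁ ∧ Span G p L n y l₂ r ∧ t < l₂ ∧ r₁ < r ∧ G.Adj x y ∧
    (IsTurn E (p (t - 1)) (p t) x ∨ IsTurn E (p t) x y ∨ IsTurn E x y (p r) ∨
      IsTurn E y (p r) (p (r + 1)))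

/-- `v` is a vertex of `p` beyond `p t`, or attached to `p` only beyond `p t`. -/
def Beyond {V : Type} (G : SimpleGraph V) (p : ℕ → V) (L n t : ℕ) (v : V) : Prop :=
  (∃ j, t + 1 ≤ j ∧ j ≤ L ∧ v = p j) ∨ ∃ l r, Span G p L n v l r ∧ t + 1 ≤ l

/-- There is an induced path with at least `N` turns which starts at `p t` and continues
beyond `p t`. -/
def TurnPath {V : Type} (E : V → V → Prop) (G : SimpleGraph V) (p : ℕ → V) (L n t N : ℕ) : Prop :=
  ∃ (q : ℕ → V) (m : ℕ) (S : Finset ℕ), IndSeq G q m ∧ 0 < m ∧ q 0 = p t ∧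
    (∀ i, 0 < i → i < m → Beyond G p L n t (q i)) ∧ S.card = N ∧
    ∀ i ∈ S, i + 2 < m ∧ IsTurn E (q i) (q (i + 1)) (q (i + 2))

section Turns

variable {V : Type} {E : V → V → Prop} {G : SimpleGraph V} {n L : ℕ} {p : ℕ → V} {x v : V}
  {l r s t N : ℕ}

theorem Only.cons_succ {q : ℕ → V} {m : ℕ} {a : V} (hxa : G.Adj x a) (hx : Off G x q m) :
    Only G x (seqCons a q) (m + 1) := by
  intro i hi
  cases i with
  | zero => simpa using ⟨hxa.ne, hxa⟩
  | succ i => simpa using hx i (by omega)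

theorem Off.cons_succ {q : ℕ → V} {m : ℕ} {a : V} (hne : x ≠ a) (hxa : ¬ G.Adj x a)
    (hx : Off G x q m) : Off G x (seqCons a q) (m + 1) := by
  intro i hi
  cases i with
  | zero => simpa using ⟨hne, hxa⟩
  | succ i => simpa using hx i (by omega)

theorem Beyond.mono (h : Beyond G p L n t v) (hs : s ≤ t) : Beyond G p L n s v := by
  rcases h with ⟨j, h1, h2, h3⟩ | ⟨l, r, h1, h2⟩
  · exact Or.inl ⟨j, by omega, h2, h3⟩
  · exact Or.inr ⟨l, r, h1, by omega⟩

theorem Beyond.far_path (h : Beyond G p L n t v) (hp : IndSeq G p (L + 1)) {c : ℕ} (hc : c < t)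
    (ht : t ≤ L) : p c ≠ v ∧ ¬ G.Adj (p c) v := by
  rcases h with ⟨j, h1, h2, rfl⟩ | ⟨l, r, h1, h2⟩
  · exact hp.far (by omega) (by omega) (by omega)
  · have := h1.lo c (by omega)
    exact ⟨this.1.symm, fun h => this.2 h.symm⟩

theorem Beyond.far_span (h : Beyond G p L n t v) (hA : ArmFree n G) (hp : IndSeq G p (L + 1))
    (hx : Span G p L n x l r) (hr : r < t) : x ≠ v ∧ ¬ G.Adj x v := by
  rcases h with ⟨j, h1, h2, rfl⟩ | ⟨l', r', h1, h2⟩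
  · exact hx.hi j (by omega) h2
  · have hlr := hx.hlr
    refine ⟨?_, fun h => ?_⟩
    · rintro rfl
      have := hx.unique h1
      omega
    · have := hx.close h1 hA hp h
      omega

theorem TurnPath.last : TurnPath E G p L n L 0 :=
  ⟨fun _ => p L, 1, ∅, fun i j hij hj => by omega, one_pos, rfl, fun i hi hi' => by omega, rfl,
    fun i hi => absurd hi (Finset.notMem_empty i)⟩

theorem TurnPath.step (h : TurnPath E G p L n (t + 1) N) (hp : IndSeq G p (L + 1))
    (ht : t + 1 ≤ L) : TurnPath E G p L n t N := by
  obtain ⟨q, m, S, hq, hm, h0, hB, hS, hT⟩ := h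
  refine ⟨seqCons (p t) q, m + 1, S.map (addRightEmbedding 1), hq.cons_succ ?_, by omega, rfl, ?_,
    by rw [Finset.card_map, hS], ?_⟩
  · intro i hi
    rcases Nat.eq_zero_or_pos i with rfl | hi0
    · rw [h0]
      simpa using ⟨hp.ne (by omega) (by omega) (by omega),
        hp.next (by omega) (by omega) (by omega)⟩
    · have := (hB i hi0 hi).far_path hp (c := t) (by omega) ht
      exact ⟨this.1, iff_of_false this.2 (by omega)⟩
  · intro i hi hi'
    obtain ⟨i, rfl⟩ : ∃ k, i = k + 1 := ⟨i - 1, by omega⟩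
    rw [seqCons_succ]
    rcases Nat.eq_zero_or_pos i with rfl | hi0
    · exact Or.inl ⟨t + 1, by omega, ht, h0⟩
    · exact (hB i hi0 (by omega)).mono (by omega)
  · intro i hi
    obtain ⟨j, hj, rfl⟩ := Finset.mem_map.1 hi
    have := hT j hj
    exact ⟨by simp only [addRightEmbedding_apply]; omega, this.2⟩

theorem TurnAt.bounds (h : TurnAt E G p L n t) : n + 1 ≤ t ∧ t ≤ L := by
  obtain ⟨x, y, r₁, l₂, r, hx, -⟩ := h
  have := hx.hl
  have := hx.hr
  have := hx.hlr
  omega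

theorem TurnAt.turnPath (h : TurnAt E G p L n t) (hA : ArmFree n G) (hp : IndSeq G p (L + 1)) :
    ∃ s, t < s ∧ s ≤ t + 8 ∧ s ≤ L ∧
      ∀ N, TurnPath E G p L n s N → TurnPath E G p L n (t - 1) (N + 1) := by
  obtain ⟨x, y, r₁, l₂, r, hx, hy, htl, hrr, hxy, hturn⟩ := h
  have hx1 := hx.hl
  have hx2 := hx.hlr
  have hx3 := hx.hr
  have hy1 := hy.hl
  have hy2 := hy.hlr
  have hy3 := hy.hr
  have hx4 := hx.le_add_three hA hp
  have hy4 := hy.le_add_three hA hp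
  have hc := hx.close hy hA hp hxy
  refine ⟨r + 1, by omega, by omega, by omega, ?_⟩
  rintro N ⟨q, m, S, hq, hm, h0, hB, hS, hT⟩
  have offP : ∀ c < r, Off G (p c) q m := by
    intro c hc i hi
    rcases Nat.eq_zero_or_pos i with rfl | hi0
    · rw [h0]
      exact hp.far (by omega) (by omega) (by omega)
    · exact (hB i hi0 hi).far_path hp (by omega) (by omega)
  have offS : ∀ {u : V} {a b : ℕ}, Span G p L n u a b → b ≤ r → Off G u q m := by
    intro u a b hu hb i hi
    rcases Nat.eq_zero_or_pos i with rfl | hi0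
    · rw [h0]
      exact hu.hi _ (by omega) (by omega)
    · exact (hB i hi0 hi).far_span hA hp hu (by omega)
  have onlyR : Only G (p r) q m := by
    intro i hi
    rcases Nat.eq_zero_or_pos i with rfl | hi0
    · rw [h0]
      simpa using ⟨hp.ne (by omega) (by omega) (by omega),
        hp.next (by omega) (by omega) (by omega)⟩
    · have := (hB i hi0 hi).far_path hp (c := r) (by omega) (by omega)
      exact ⟨this.1, iff_of_false this.2 (by omega)⟩
  have farX : ∀ c < t, p c ≠ x ∧ ¬ G.Adj (p c) x := fun c hc =>
    ⟨(hx.lo c hc).1.symm, fun h => (hx.lo c hc).2 h.symm⟩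
  have farY : ∀ c < l₂, p c ≠ y ∧ ¬ G.Adj (p c) y := fun c hc =>
    ⟨(hy.lo c hc).1.symm, fun h => (hy.lo c hc).2 h.symm⟩
  have farR : ∀ c, c + 1 < r → p c ≠ p r ∧ ¬ G.Adj (p c) (p r) := fun c hc =>
    hp.far (by omega) (by omega) (by omega)
  have farXR := hx.hi r hrr (by omega)
  have i₁ := hq.cons_succ onlyR
  have i₂ := i₁.cons_succ (Only.cons_succ hy.ar (offS hy le_rfl))
  have i₃ := i₂.cons_succ (Only.cons_succ hxy (Off.cons_succ farXR.1 farXR.2 (offS hx (by omega))))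
  have i₄ := i₃.cons_succ (Only.cons_succ hx.al.symm (Off.cons_succ (farY t htl).1 (farY t htl).2
    (Off.cons_succ (farR t (by omega)).1 (farR t (by omega)).2 (offP t (by omega)))))
  have i₅ := i₄.cons_succ (Only.cons_succ (hp.next (i := t - 1) (j := t) (by omega) (by omega) (by omega))
    (Off.cons_succ (farX (t - 1) (by omega)).1 (farX (t - 1) (by omega)).2
      (Off.cons_succ (farY (t - 1) (by omega)).1 (farY (t - 1) (by omega)).2
        (Off.cons_succ (farR (t - 1) (by omega)).1 (farR (t - 1) (by omega)).2
          (offP (t - 1) (by omega))))))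
  obtain ⟨k, hk, hkt⟩ : ∃ k < 4, IsTurn E
      (seqCons (p (t - 1)) (seqCons (p t) (seqCons x (seqCons y (seqCons (p r) q)))) k)
      (seqCons (p (t - 1)) (seqCons (p t) (seqCons x (seqCons y (seqCons (p r) q)))) (k + 1))
      (seqCons (p (t - 1)) (seqCons (p t) (seqCons x (seqCons y (seqCons (p r) q)))) (k + 2)) := by
    rcases hturn with h | h | h | h
    · exact ⟨0, by omega, h⟩
    · exact ⟨1, by omega, h⟩
    · exact ⟨2, by omega, h⟩
    · refine ⟨3, by omega, ?_⟩
      simpa only [seqCons_succ, seqCons_zero, h0] using h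
  refine ⟨_, m + 5, insert k (S.map (addRightEmbedding 5)), i₅, by omega, rfl, ?_, ?_, ?_⟩
  · intro i hi hi'
    match i, hi with
    | 1, _ => exact Or.inl ⟨t, by omega, by omega, rfl⟩
    | 2, _ => exact Or.inr ⟨t, r₁, hx, by omega⟩
    | 3, _ => exact Or.inr ⟨l₂, r, hy, by omega⟩
    | 4, _ => exact Or.inl ⟨r, by omega, by omega, rfl⟩
    | 5, _ => exact Or.inl ⟨r + 1, by omega, by omega, h0⟩
    | i + 6, _ => exact (hB (i + 1) (by omega) (by omega)).mono (by omega)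
  · rw [Finset.card_insert_of_notMem, Finset.card_map, hS]
    intro hmem
    obtain ⟨j, -, hj⟩ := Finset.mem_map.1 hmem
    simp only [addRightEmbedding_apply] at hj
    omega
  · intro i hi
    rcases Finset.mem_insert.1 hi with rfl | hi
    · exact ⟨by omega, hkt⟩
    · obtain ⟨j, hj, rfl⟩ := Finset.mem_map.1 hi
      have := hT j hj
      exact ⟨by simp only [addRightEmbedding_apply]; omega, this.2⟩

theorem TurnPath.le (h : TurnPath E G p L n t N) (hGE : ∀ u v, G.Adj u v ↔ E u v ∨ E v u)
    (h3 : CondD3 n E) : N ≤ n := by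
  obtain ⟨q, m, S, hq, hm, h0, hB, rfl, hT⟩ := h
  refine le_trans ?_ (h3 m (fun i => q i) ⟨fun i j hij => ?_, fun i j => ?_⟩)
  · rw [turnCount, ← Set.ncard_coe_finset S]
    refine Set.ncard_le_ncard_of_injOn (fun i => if h : i + 1 < m then ⟨i + 1, h⟩ else ⟨0, hm⟩)
      ?_ ?_ (Set.toFinite _)
    · intro i hi
      obtain ⟨h1, h2⟩ := hT i hi
      simp only [dif_pos (show i + 1 < m by omega)]
      exact ⟨⟨i, by omega⟩, ⟨i + 2, h1⟩, rfl, rfl, h2⟩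
    · intro i hi j hj hij
      have h1 := (hT i hi).1
      have h2 := (hT j hj).1
      simp only [dif_pos (show i + 1 < m by omega), dif_pos (show j + 1 < m by omega),
        Fin.mk.injEq] at hij
      omega
  · by_contra hne
    exact hq.ne i.2 j.2 (fun h => hne (Fin.ext h)) hij
  · rw [← hGE]
    exact hq.adj_iff i.2 j.2

theorem exists_turnPath (hA : ArmFree n G) (hp : IndSeq G p (L + 1)) {T : Finset ℕ}
    (hT : ∀ t, t ∈ T ↔ TurnAt E G p L n t) (d : ℕ) :
    ∀ t, t + d = L → ∃ N, TurnPath E G p L n t N ∧ (T.filter (t < ·)).card ≤ 9 * N := by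
  induction d using Nat.strong_induction_on with
  | _ d ih =>
    intro t ht
    rcases Nat.eq_zero_or_pos d with rfl | hd
    · obtain rfl : t = L := ht
      refine ⟨0, TurnPath.last, ?_⟩
      rw [Nat.mul_zero, Nat.le_zero, Finset.card_eq_zero, Finset.filter_eq_empty_iff]
      intro s hs
      have := ((hT s).1 hs).bounds
      omega
    · by_cases htt : TurnAt E G p L n (t + 1)
      · obtain ⟨s, h1, h2, h4, h⟩ := htt.turnPath hA hp
        obtain ⟨N, hN, hc⟩ := ih (L - s) (by omega) s (by omega)
        refine ⟨N + 1, h N hN, ?_⟩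
        have hsub : T.filter (t < ·) ⊆ T.filter (s < ·) ∪ Finset.Ioc t s := by
          intro i hi
          simp only [Finset.mem_union, Finset.mem_filter, Finset.mem_Ioc] at hi ⊢
          rcases Nat.lt_or_ge s i with h | h
          · exact Or.inl ⟨hi.1, h⟩
          · exact Or.inr ⟨hi.2, h⟩
        have := (Finset.card_le_card hsub).trans (Finset.card_union_le _ _)
        rw [Nat.card_Ioc] at this
        omega
      · obtain ⟨N, hN, hc⟩ := ih (d - 1) (by omega) (t + 1) (by omega)
        refine ⟨N, hN.step hp (by omega), le_trans (Finset.card_le_card ?_) hc⟩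
        intro i hi
        simp only [Finset.mem_filter] at hi ⊢
        refine ⟨hi.1, lt_of_le_of_ne hi.2 ?_⟩
        rintro rfl
        exact htt ((hT _).1 hi.1)

/-- Turns can be produced at boundedly many places only. -/
theorem card_turnAt_le (hA : ArmFree n G) (hp : IndSeq G p (L + 1))
    (hGE : ∀ u v, G.Adj u v ↔ E u v ∨ E v u) (h3 : CondD3 n E) {T : Finset ℕ}
    (hT : ∀ t, t ∈ T ↔ TurnAt E G p L n t) : T.card ≤ 9 * n := by
  obtain ⟨N, hN, hc⟩ := exists_turnPath hA hp hT L 0 (by omega)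
  have hN' := hN.le hGE h3
  rw [Finset.filter_true_of_mem] at hc
  · omega
  · intro t ht
    have := ((hT t).1 ht).bounds
    omega

end Turns

/-! ## Local structure away from turns -/

/-- A vertex attached to the middle arc of a long directed induced path can be inserted. -/
def Insertable {V : Type} (n : ℕ) (G : SimpleGraph V) (E : V → V → Prop) : Prop :=
  ∀ ⦃y z : ℕ → V⦄ ⦃x : V⦄, IndSeq G y n → IndSeq G z n → Link G y z n → Only G x y n →
    Only G x z n → (∀ i, i + 1 < n → E (y (i + 1)) (y i)) → E (y 0) (z 0) →
    (∀ i, i + 1 < n → E (z i) (z (i + 1))) → E (y 0) x ∧ E x (z 0)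

theorem Insertable.flip {V : Type} {n : ℕ} {G : SimpleGraph V} {E : V → V → Prop}
    (h : Insertable n G E) : Insertable n G (fun u v => E v u) :=
  fun _ _ _ hy hz hyz hxy hxz dy dyz dz => (h hz hy hyz.symm hxz hxy dz dyz dy).symm

/-- Between `p lo` and `p hi` the path `p` is directed forward, and so are all its reroutings. -/
structure ForwardFlow {V : Type} (E : V → V → Prop) (G : SimpleGraph V) (p : ℕ → V) (L n lo hi : ℕ) :
    Prop where
  dir : ∀ i, lo ≤ i → i < hi → E (p i) (p (i + 1))
  cross : ∀ x y l r l' r', Span G p L n x l r → Span G p L n y l' r' → l < l' → r < r' →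
    G.Adj x y → lo ≤ l → r' ≤ hi → E (p l) x ∧ E x y ∧ E y (p r')

section Window

variable {V : Type} {E : V → V → Prop} {G : SimpleGraph V} {n L : ℕ} {p : ℕ → V}
  {lo hi : ℕ}

theorem arrows_cons {a : V} {q : ℕ → V} (ha : E a (q 0)) (hq : ∀ i, i + 1 < n → E (q i) (q (i + 1))) :
    ∀ i, i + 1 < n → E (seqCons a q i) (seqCons a q (i + 1)) := by
  intro i hi
  cases i with
  | zero => exact ha
  | succ i => exact hq i (by omega)

namespace ForwardFlow

theorem armL (hF : ForwardFlow E G p L n lo hi) {l : ℕ} (hl : lo + n ≤ l) (hl' : l ≤ hi) :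
    ∀ i, i + 1 < n → E (armL p l (i + 1)) (armL p l i) := by
  intro i hi'
  have := hF.dir (l - (i + 1)) (by omega) (by omega)
  rwa [show l - (i + 1) + 1 = l - i by omega] at this

theorem armR (hF : ForwardFlow E G p L n lo hi) {r : ℕ} (hr : r + n ≤ hi) (hr' : lo ≤ r) :
    ∀ i, i + 1 < n → E (armR p r i) (armR p r (i + 1)) :=
  fun i _ => hF.dir (r + i) (by omega) (by omega)

theorem single (hF : ForwardFlow E G p L n lo hi) (hp : IndSeq G p (L + 1)) (hL : hi + 2 ≤ L) (hn : 0 < n)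
    {w : V} {l r : ℕ} (h : Span G p L n w l r) (hl : lo + n ≤ l) (hr : r + n ≤ hi)
    (hlr : l + 2 ≤ r) : E (p l) w ∧ E w (p r) := by
  have := h.hl
  obtain ⟨h1, h2, -⟩ := hF.cross w (p r) l r (r - 1) (r + 1) h
    (Span.of_path hp (by omega) (by omega)) (by omega) (by omega) h.ar (by omega) (by omega)
  exact ⟨h1, h2⟩

variable {u v w : V} {lu ru lv rv lw rw : ℕ}

theorem arc_of_left_eq (hF : ForwardFlow E G p L n lo hi) (hI : Insertable n G E) (hA : ArmFree n G)
    (hp : IndSeq G p (L + 1)) (hL : hi + 2 ≤ L) (hn : 0 < n) {l : ℕ}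
    (hv : Span G p L n v l rv) (hw : Span G p L n w l rw) (hr : rv < rw) (hl : lo + n ≤ l)
    (hr' : rw + n ≤ hi) : E v w := by
  have h1 := hv.hlr
  have h2 := hw.hr
  have hvw : v ≠ w := by
    rintro rfl
    have := hv.unique hw
    omega
  obtain ⟨e1, e2⟩ := hF.single hp hL hn hw hl hr' (by omega)
  exact (hI (hw.indL hp) (hw.ind_cons hp) (hw.link_cons hp (by omega)) hv.onlyL
    (Only.cons (hv.adj_of_left_eq hw hA hp hvw) (hv.offR hr (by omega)))
    (hF.armL hl (by omega)) e1 (arrows_cons e2 (hF.armR hr' (by omega)))).2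

theorem arc_of_right_eq (hF : ForwardFlow E G p L n lo hi) (hI : Insertable n G E) (hA : ArmFree n G)
    (hp : IndSeq G p (L + 1)) (hL : hi + 2 ≤ L) (hn : 0 < n) {r : ℕ}
    (hu : Span G p L n u lu r) (hv : Span G p L n v lv r) (hl : lu < lv) (hl' : lo + n ≤ lu)
    (hr : r + n ≤ hi) : E u v := by
  have h1 := hv.hlr
  have h2 := hu.hr
  have huv : v ≠ u := by
    rintro rfl
    have := hv.unique hu
    omega
  obtain ⟨e1, e2⟩ := hF.single hp hL hn hu hl' hr (by omega)
  exact (hI (hu.ind_cons_left hp) (hu.indR hp) (hu.link_cons_left hp (by omega))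
    (Only.cons (hv.adj_of_right_eq hu hA hp huv) (hv.offL hl)) hv.onlyR
    (arrows_cons (E := fun a b => E b a) e1 (hF.armL hl' (by omega))) e2
    (hF.armR hr (by omega))).1

theorem arc_into_of_strict (hF : ForwardFlow E G p L n lo hi) (hI : Insertable n G E) (hA : ArmFree n G)
    (hp : IndSeq G p (L + 1)) (hL : hi + 2 ≤ L) (hn : 0 < n)
    (hu : Span G p L n u lu ru) (hv : Span G p L n v lv rv) (hw : Span G p L n w lw rw)
    (huv : G.Adj u v) (hvw : G.Adj v w) (huw : u ≠ w) (huw' : ¬ G.Adj u w) (hr : ru < rw)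
    (hl1 : lo + n ≤ lu) (hl2 : lo + n ≤ lv) (hr2 : rv + n ≤ hi) (hr3 : rw + n ≤ hi)
    (hs : lv < lw) (hs' : rv < rw) : E u v := by
  have h1 := hu.hlr
  have h2 := hw.hr
  have h3 := hv.hlr
  rcases lt_trichotomy lu lv with h | rfl | h
  · rcases (hu.not_nested hv hA hp h).lt_or_eq with h' | rfl
    · exact (hF.cross _ _ _ _ _ _ hu hv h h' huv (by omega) (by omega)).2.1
    · exact hF.arc_of_right_eq hI hA hp hL hn hu hv h hl1 hr2
  · obtain ⟨e1, e2, e3⟩ := hF.cross _ _ _ _ _ _ hv hw hs hs' hvw (by omega) (by omega)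
    exact (hI (hv.indL hp) ((hw.ind_cons hp).cons (Only.cons hvw (hv.offR hs' (by omega))))
      ((hw.apart_cons hp hs).consLink hv.onlyL) hu.onlyL
      (Only.cons huv (Off.cons huw huw' (hu.offR hr (by omega))))
      (hF.armL hl2 (by omega)) e1
      (arrows_cons e2 (arrows_cons e3 (hF.armR hr3 (by omega))))).2
  · exact (hA.noF1 (hv.indL hp) (hw.ind_cons hp) (hw.apart_cons hp hs) hv.onlyL
      (Only.cons hvw (hv.offR hs' (by omega))) (hu.offL h)
      (Off.cons huw huw' (hu.offR hr (by omega))) huv.symm).elim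

theorem arc_from_of_strict (hF : ForwardFlow E G p L n lo hi) (hI : Insertable n G E) (hA : ArmFree n G)
    (hp : IndSeq G p (L + 1)) (hL : hi + 2 ≤ L) (hn : 0 < n)
    (hu : Span G p L n u lu ru) (hv : Span G p L n v lv rv) (hw : Span G p L n w lw rw)
    (huv : G.Adj u v) (hvw : G.Adj v w) (huw : u ≠ w) (huw' : ¬ G.Adj u w) (hl : lu < lw)
    (hl1 : lo + n ≤ lu) (hl2 : lo + n ≤ lv) (hr2 : rv + n ≤ hi) (hr3 : rw + n ≤ hi)
    (hs : lu < lv) (hs' : ru < rv) : E v w := by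
  have h1 := hu.hlr
  have h2 := hv.hr
  have h3 := hv.hlr
  have hwu : ¬ G.Adj w u := fun h => huw' h.symm
  rcases lt_trichotomy rv rw with h | rfl | h
  · have hle : lv ≤ lw := by
      by_contra hlt
      have := hw.not_nested hv hA hp (by omega)
      omega
    rcases hle.lt_or_eq with h' | rfl
    · exact (hF.cross _ _ _ _ _ _ hv hw h' h hvw (by omega) (by omega)).2.1
    · exact hF.arc_of_left_eq hI hA hp hL hn hv hw h hl2 hr3
  · obtain ⟨e1, e2, e3⟩ := hF.cross _ _ _ _ _ _ hu hv hs hs' huv (by omega) (by omega)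
    exact (hI ((hu.ind_cons_left hp).cons (Only.cons huv.symm (hv.offL hs))) (hv.indR hp)
      ((hu.apart_cons_left hp hs' (by omega)).symm.consLink hv.onlyR).symm
      (Only.cons hvw.symm (Off.cons huw.symm hwu (hw.offL hl))) hw.onlyR
      (arrows_cons (E := fun a b => E b a) e2
        (arrows_cons (E := fun a b => E b a) e1 (hF.armL hl1 (by omega)))) e3
      (hF.armR hr2 (by omega))).1
  · exact (hA.noF1 (hu.ind_cons_left hp) (hv.indR hp) (hu.apart_cons_left hp hs' (by omega))
      (Only.cons huv.symm (hv.offL hs)) hv.onlyR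
      (Off.cons huw.symm hwu (hw.offL hl)) (hw.offR h (by omega)) hvw).elim

/-- Two nonadjacent neighbours of an attached vertex are an in-neighbour and an out-neighbour. -/
theorem arcs_of_not_adj (hF : ForwardFlow E G p L n lo hi) (hI : Insertable n G E) (hA : ArmFree n G)
    (hp : IndSeq G p (L + 1)) (hL : hi + 2 ≤ L) (hn : 0 < n)
    (hu : Span G p L n u lu ru) (hv : Span G p L n v lv rv) (hw : Span G p L n w lw rw)
    (huv : G.Adj u v) (hvw : G.Adj v w) (huw : u ≠ w) (huw' : ¬ G.Adj u w)
    (hl : lu < lw) (hr : ru < rw)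
    (hl1 : lo + n ≤ lu) (hl2 : lo + n ≤ lv) (hr2 : rv + n ≤ hi) (hr3 : rw + n ≤ hi) :
    E u v ∧ E v w := by
  by_cases hA1 : lv < lw ∧ rv < rw
  · exact ⟨hF.arc_into_of_strict hI hA hp hL hn hu hv hw huv hvw huw huw' hr hl1 hl2 hr2 hr3
      hA1.1 hA1.2,
      (hF.cross _ _ _ _ _ _ hv hw hA1.1 hA1.2 hvw (by omega) (by omega)).2.1⟩
  by_cases hB1 : lu < lv ∧ ru < rv
  · exact ⟨(hF.cross _ _ _ _ _ _ hu hv hB1.1 hB1.2 huv (by omega) (by omega)).2.1,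
      hF.arc_from_of_strict hI hA hp hL hn hu hv hw huv hvw huw huw' hl hl1 hl2 hr2 hr3
      hB1.1 hB1.2⟩
  have n1 : lv < lw → rv ≤ rw := hv.not_nested hw hA hp
  have n2 : lv < lu → rv ≤ ru := hv.not_nested hu hA hp
  have n3 : lu < lv → ru ≤ rv := hu.not_nested hv hA hp
  have n4 : lw < lv → rw ≤ rv := hw.not_nested hv hA hp
  rcases Nat.lt_or_ge lv lw with h | h
  · obtain rfl : rv = rw := by omega
    obtain rfl : lu = lv := by omega
    exact ⟨hF.arc_of_left_eq hI hA hp hL hn hu hv hr hl1 hr2,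
      hF.arc_of_right_eq hI hA hp hL hn hv hw h hl2 hr2⟩
  · obtain rfl : rv = ru := by omega
    obtain rfl : lv = lw := by omega
    exact ⟨hF.arc_of_right_eq hI hA hp hL hn hu hv hl hl1 hr2,
      hF.arc_of_left_eq hI hA hp hL hn hv hw hr hl2 hr3⟩

end ForwardFlow

theorem not_isTurn_next {a b c : V} (hGE : ∀ u v, G.Adj u v ↔ E u v ∨ E v u)
    (h : ¬ IsTurn E a b c) (hbc : G.Adj b c) (hab : E a b) : E b c := by
  rcases (hGE b c).1 hbc with h' | h'
  · exact h'
  · exact absurd (Or.inr ⟨hab, h'⟩) h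

theorem not_isTurn_prev {a b c : V} (hGE : ∀ u v, G.Adj u v ↔ E u v ∨ E v u)
    (h : ¬ IsTurn E a b c) (hab : G.Adj a b) (hbc : E b c) : E a b := by
  rcases (hGE a b).1 hab with h' | h'
  · exact h'
  · exact absurd (Or.inl ⟨h', hbc⟩) h

theorem not_isTurn_path (hp : IndSeq G p (L + 1)) {t : ℕ} (ht : n + 1 ≤ t) (ht' : t + n + 4 ≤ L)
    (h : ¬ TurnAt E G p L n t) : ¬ IsTurn E (p t) (p (t + 1)) (p (t + 2)) := by
  intro h'
  exact h ⟨p (t + 1), p (t + 2), t + 2, t + 1, t + 3, Span.of_path hp (by omega) (by omega),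
    Span.of_path hp (by omega) (by omega), by omega, by omega,
    hp.next (by omega) (by omega) (by omega), Or.inr (Or.inl h')⟩

/-- Away from turns the path and its reroutings are directed. -/
theorem ForwardFlow.of_not_turnAt (hp : IndSeq G p (L + 1)) (hGE : ∀ u v, G.Adj u v ↔ E u v ∨ E v u)
    (hlo : n + 1 ≤ lo) (hhi : hi + n + 4 ≤ L) (hT : ∀ t, lo ≤ t → t ≤ hi → ¬ TurnAt E G p L n t)
    {i : ℕ} (hi1 : lo ≤ i) (hi2 : i < hi) (hE : E (p i) (p (i + 1))) :
    ForwardFlow E G p L n (lo + 1) hi := by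
  have up : ∀ d, i + d < hi → E (p (i + d)) (p (i + d + 1)) := by
    intro d
    induction d with
    | zero => exact fun _ => hE
    | succ d ih =>
      intro hd
      exact not_isTurn_next hGE (not_isTurn_path hp (t := i + d) (by omega) (by omega)
        (hT _ (by omega) (by omega))) (hp.next (by omega) (by omega) (by omega)) (ih (by omega))
  have down : ∀ d, lo + d ≤ i → E (p (i - d)) (p (i - d + 1)) := by
    intro d
    induction d with
    | zero => exact fun _ => hE
    | succ d ih =>
      intro hd
      have h1 := ih (by omega)
      have h2 := not_isTurn_path hp (t := i - (d + 1)) (by omega) (by omega)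
        (hT (i - (d + 1)) (by omega) (by omega))
      refine not_isTurn_prev hGE h2 (hp.next (by omega) (by omega) (by omega)) ?_
      rwa [show i - (d + 1) + 1 = i - d by omega, show i - (d + 1) + 2 = i - d + 1 by omega]
  have dir : ∀ j, lo ≤ j → j < hi → E (p j) (p (j + 1)) := by
    intro j hj hj'
    rcases Nat.le_total i j with h | h
    · have := up (j - i) (by omega)
      rwa [show i + (j - i) = j by omega] at this
    · have := down (i - j) (by omega)
      rwa [show i - (i - j) = j by omega] at this
  refine ⟨fun j hj hj' => dir j (by omega) hj', ?_⟩
  intro x y l r l' r' hx hy hl hr hxy hlo' hhi'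
  have h1 := hx.hlr
  have nt : ¬ (IsTurn E (p (l - 1)) (p l) x ∨ IsTurn E (p l) x y ∨ IsTurn E x y (p r') ∨
      IsTurn E y (p r') (p (r' + 1))) :=
    fun h => hT l (by omega) (by omega) ⟨x, y, r, l', r', hx, hy, hl, hr, hxy, h⟩
  have e0 := dir (l - 1) (by omega) (by omega)
  rw [show l - 1 + 1 = l by omega] at e0
  have e1 := not_isTurn_next hGE (fun h => nt (Or.inl h)) hx.al.symm e0
  have e2 := not_isTurn_next hGE (fun h => nt (Or.inr (Or.inl h))) hxy e1
  exact ⟨e1, e2, not_isTurn_next hGE (fun h => nt (Or.inr (Or.inr (Or.inl h)))) hy.ar e2⟩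

/-- Away from turns and from the ends of the path, nonadjacent neighbours of an attached vertex
are not both in-neighbours, and not both out-neighbours. -/
theorem adj_of_same_side (hE : ∀ u v, E u v → ¬ E v u) (hn : 0 < n) (hI : Insertable n G E)
    (hA : ArmFree n G) (hp : IndSeq G p (L + 1)) (hGE : ∀ u v, G.Adj u v ↔ E u v ∨ E v u)
    {i rv lu ru lw rw : ℕ} (hi1 : 2 * n + 6 ≤ i) (hi2 : i + 2 * n + 11 ≤ L)
    (hT : ∀ t, i ≤ t + n + 5 → t ≤ i + n + 7 → ¬ TurnAt E G p L n t) {u v w : V}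
    (hv : Span G p L n v i rv) (hu : Span G p L n u lu ru) (hw : Span G p L n w lw rw)
    (huw : u ≠ w) (h : (E u v ∧ E w v) ∨ (E v u ∧ E v w)) : G.Adj u w := by
  by_contra hna
  have huv : G.Adj u v := (hGE _ _).2 (by tauto)
  have hvw : G.Adj v w := (hGE _ _).2 (by tauto)
  have c1 := hu.close hv hA hp huv
  have c2 := hv.close hu hA hp huv.symm
  have c3 := hw.close hv hA hp hvw.symm
  have c4 := hv.close hw hA hp hvw
  have t1 := hu.le_add_three hA hp
  have t2 := hv.le_add_three hA hp
  have t3 := hw.le_add_three hA hp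
  have key : ∀ {E : V → V → Prop}, (∀ u v, E u v → ¬ E v u) → Insertable n G E →
      (∀ u v, G.Adj u v ↔ E u v ∨ E v u) →
      (∀ t, i ≤ t + n + 5 → t ≤ i + n + 7 → ¬ TurnAt E G p L n t) → E (p i) (p (i + 1)) →
      ((E u v ∧ E w v) ∨ (E v u ∧ E v w)) → False := by
    intro E hE hI hGE hT he h
    have hF := ForwardFlow.of_not_turnAt (lo := i - n - 5) (hi := i + n + 7) hp hGE (by omega) (by omega)
      (fun t h1 h2 => hT t (by omega) (by omega)) (i := i) (by omega) (by omega) he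
    rcases hu.strict_of_not_adj hw hA hp huw hna with ⟨h1, h2⟩ | ⟨h1, h2⟩
    · obtain ⟨e1, e2⟩ := hF.arcs_of_not_adj hI hA hp (by omega) hn hu hv hw huv hvw huw hna h1 h2
        (by omega) (by omega) (by omega) (by omega)
      have := hE _ _ e1
      have := hE _ _ e2
      tauto
    · obtain ⟨e1, e2⟩ := hF.arcs_of_not_adj hI hA hp (by omega) hn hw hv hu hvw.symm huv.symm
        huw.symm (fun h => hna h.symm) h1 h2 (by omega) (by omega) (by omega) (by omega)
      have := hE _ _ e1
      have := hE _ _ e2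
      tauto
  rcases (hGE (p i) (p (i + 1))).1 (hp.next (by omega) (by omega) (by omega)) with he | he
  · exact key hE hI hGE hT he h
  · refine key (E := fun u v => E v u) (fun a b hab hba => hE _ _ hab hba) hI.flip
      (fun a b => by rw [hGE, or_comm]) ?_ he h.symm
    intro t ht ht' ⟨x, y, r₁, l₂, r, h1, h2, h3, h4, h5, h6⟩
    exact hT t ht ht' ⟨x, y, r₁, l₂, r, h1, h2, h3, h4, h5, by simpa only [IsTurn, or_comm] using h6⟩

end Window

/-! ## Partitioning the vertices attached to the middle of the path -/

section Middle

variable {V : Type} [Fintype V]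

open Classical in
/-- The vertices whose first neighbour on the path is `p l` for some `l` with `s ≤ l < t`. -/
noncomputable def midSet (G : SimpleGraph V) (p : ℕ → V) (L n s t : ℕ) : Finset V :=
  Finset.univ.filter fun x => ∃ l r, Span G p L n x l r ∧ s ≤ l ∧ l < t

variable {E : V → V → Prop} {G : SimpleGraph V} {n L : ℕ} {p : ℕ → V} {s t : ℕ}

theorem mem_midSet {x : V} :
    x ∈ midSet G p L n s t ↔ ∃ l r, Span G p L n x l r ∧ s ≤ l ∧ l < t := by
  simp [midSet]

theorem midSet_self : midSet G p L n s s = ∅ := by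
  refine Finset.eq_empty_of_forall_notMem fun x hx => ?_
  obtain ⟨l, r, -, h1, h2⟩ := mem_midSet.1 hx
  omega

theorem midSet_disjoint {m : ℕ} : Disjoint (midSet G p L n s m) (midSet G p L n m t) := by
  rw [Finset.disjoint_left]
  intro x hx hx'
  obtain ⟨l, r, h, h1, h2⟩ := mem_midSet.1 hx
  obtain ⟨l', r', h', h3, h4⟩ := mem_midSet.1 hx'
  have := h.unique h'
  omega

variable [DecidableEq V]

theorem midSet_union {m : ℕ} (h1 : s ≤ m) (h2 : m ≤ t) :
    midSet G p L n s m ∪ midSet G p L n m t = midSet G p L n s t := by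
  ext x
  simp only [Finset.mem_union, mem_midSet]
  constructor
  · rintro (⟨l, r, h, h3, h4⟩ | ⟨l, r, h, h3, h4⟩)
    · exact ⟨l, r, h, h3, by omega⟩
    · exact ⟨l, r, h, by omega, h4⟩
  · rintro ⟨l, r, h, h3, h4⟩
    rcases Nat.lt_or_ge l m with h5 | h5
    · exact Or.inl ⟨l, r, h, h3, h5⟩
    · exact Or.inr ⟨l, r, h, h5, h4⟩

theorem hasPathPart_midSet_succ (hE : ∀ u v, E u v → ¬ E v u) (hA : ArmFree n G)
    (hp : IndSeq G p (L + 1)) (hGE : ∀ u v, G.Adj u v ↔ E u v ∨ E v u) :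
    HasPathPart E (midSet G p L n t (t + 1)) 1 := by
  refine HasPathPart.of_indep (fun u h => hE u u h h) fun I hI hind => ?_
  rw [Finset.card_le_one]
  intro a ha b hb
  by_contra hne
  obtain ⟨l, r, h, h1, h2⟩ := mem_midSet.1 (hI ha)
  obtain ⟨l', r', h', h3, h4⟩ := mem_midSet.1 (hI hb)
  obtain rfl : l = l' := by omega
  rcases (hGE a b).1 (h.adj_of_left_eq h' hA hp hne) with h5 | h5
  · exact hind a ha b hb h5
  · exact hind b hb a ha h5

theorem exists_adj_out_of_midSet (hA : ArmFree n G) (hp : IndSeq G p (L + 1)) (ht : t + n + 2 ≤ L)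
    (hs : n + 1 ≤ s) {S : Finset V} (hS : S ⊆ midSet G p L n s t) (hne : S.Nonempty)
    (hS' : S ≠ midSet G p L n s t) :
    ∃ v ∈ S, ∃ u ∈ midSet G p L n s t, u ∉ S ∧ G.Adj u v := by
  by_contra hcon
  push Not at hcon
  have hclosed : ∀ v ∈ S, ∀ u ∈ midSet G p L n s t, G.Adj u v → u ∈ S := by
    intro v hv u hu h
    by_contra hn
    exact hcon v hv u hu hn h
  have hsp : ∀ i, s ≤ i → i < t → Span G p L n (p (i + 1)) i (i + 2) := fun i h1 h2 =>
    Span.of_path hp (by omega) (by omega)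
  have hmem : ∀ i, s ≤ i → i < t → p (i + 1) ∈ midSet G p L n s t := fun i h1 h2 =>
    mem_midSet.2 ⟨i, _, hsp i h1 h2, h1, h2⟩
  obtain ⟨x, hx⟩ := hne
  obtain ⟨i, r, hxs, h1, h2⟩ := mem_midSet.1 (hS hx)
  have base : p (i + 1) ∈ S := by
    by_cases hxi : p (i + 1) = x
    · rwa [hxi]
    · exact hclosed x hx _ (hmem i h1 h2) ((hsp i h1 h2).adj_of_left_eq hxs hA hp hxi)
  have up : ∀ d, i + d < t → p (i + d + 1) ∈ S := by
    intro d
    induction d with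
    | zero => exact fun _ => base
    | succ d ih =>
      exact fun hd => hclosed _ (ih (by omega)) _ (hmem (i + d + 1) (by omega) hd)
        (hp.next (by omega) (by omega) (by omega))
  have down : ∀ d, s + d ≤ i → p (i - d + 1) ∈ S := by
    intro d
    induction d with
    | zero => exact fun _ => base
    | succ d ih =>
      exact fun hd => hclosed _ (ih (by omega)) _ (hmem (i - (d + 1)) (by omega) (by omega))
        (hp.next (by omega) (by omega) (by omega))
  refine hS' (Finset.Subset.antisymm hS fun y hy => ?_)
  obtain ⟨j, r', hys, h3, h4⟩ := mem_midSet.1 hy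
  have hj : p (j + 1) ∈ S := by
    rcases Nat.le_total i j with h | h
    · have := up (j - i) (by omega)
      rwa [show i + (j - i) = j by omega] at this
    · have := down (i - j) (by omega)
      rwa [show i - (i - j) = j by omega] at this
  by_cases hyj : y = p (j + 1)
  · rwa [hyj]
  · exact hclosed _ hj y hy (hys.adj_of_left_eq (hsp j h3 h4) hA hp hyj)

theorem hasPathPart_midSet (hE : ∀ u v, E u v → ¬ E v u) (hn : 0 < n) (hI : Insertable n G E)
    (hA : ArmFree n G) (hp : IndSeq G p (L + 1)) (hGE : ∀ u v, G.Adj u v ↔ E u v ∨ E v u)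
    (hgood : ∀ i, s ≤ i → i < t → 2 * n + 6 ≤ i ∧ i + 2 * n + 11 ≤ L ∧
      ∀ k, i ≤ k + n + 5 → k ≤ i + n + 7 → ¬ TurnAt E G p L n k) :
    HasPathPart E (midSet G p L n s t) 1 := by
  have key : ∀ v ∈ midSet G p L n s t, ∀ u ∈ midSet G p L n s t, ∀ w ∈ midSet G p L n s t,
      ((E u v ∧ E w v) ∨ (E v u ∧ E v w)) → u ≠ w → E u w ∨ E w u := by
    intro v hv u hu w hw h huw
    obtain ⟨i, rv, hv, h1, h2⟩ := mem_midSet.1 hv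
    obtain ⟨lu, ru, hu, -⟩ := mem_midSet.1 hu
    obtain ⟨lw, rw, hw, -⟩ := mem_midSet.1 hw
    obtain ⟨g1, g2, g3⟩ := hgood i h1 h2
    exact (hGE u w).1 (adj_of_same_side hE hn hI hA hp hGE g1 g2 g3 hv hu hw huw h)
  refine HasPathPart.of_locally_semicomplete
    (fun v hv u hu w hw h h' => key v hv u hu w hw (Or.inl ⟨h, h'⟩))
    (fun v hv u hu w hw h h' => key v hv u hu w hw (Or.inr ⟨h, h'⟩)) fun S hS hne hS' => ?_
  obtain ⟨x, hx⟩ := hne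
  obtain ⟨l, r, -, h1, h2⟩ := mem_midSet.1 (hS hx)
  have g1 := hgood s le_rfl (by omega)
  have g2 := hgood (t - 1) (by omega) (by omega)
  obtain ⟨v, hv, u, hu, hu', h⟩ :=
    exists_adj_out_of_midSet hA hp (by omega) (by omega) hS ⟨x, hx⟩ hS'
  exact ⟨v, hv, u, hu, hu', (hGE u v).1 h⟩

theorem hasPathPart_midSet_of_bad (hE : ∀ u v, E u v → ¬ E v u) (hn : 0 < n)
    (hI : Insertable n G E) (hA : ArmFree n G) (hp : IndSeq G p (L + 1))
    (hGE : ∀ u v, G.Adj u v ↔ E u v ∨ E v u) {B : Finset ℕ}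
    (hB : ∀ i < L, i ∉ B → 2 * n + 6 ≤ i ∧ i + 2 * n + 11 ≤ L ∧
      ∀ k, i ≤ k + n + 5 → k ≤ i + n + 7 → ¬ TurnAt E G p L n k) :
    HasPathPart E (midSet G p L n 0 L) (2 * B.card + 1) := by
  have key : ∀ t ≤ L, ∃ s ≤ t, (∀ i, s ≤ i → i < t → i ∉ B) ∧
      HasPathPart E (midSet G p L n 0 s) (2 * (B.filter (· < s)).card) := by
    intro t
    induction t with
    | zero =>
      refine fun _ => ⟨0, le_rfl, fun i _ h => by omega, ?_⟩
      rw [midSet_self]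
      exact HasPathPart.empty.mono (Nat.zero_le _)
    | succ t ih =>
      intro ht
      obtain ⟨s, hs, hgood, hpart⟩ := ih (by omega)
      by_cases htB : t ∈ B
      · refine ⟨t + 1, le_rfl, fun i _ h => by omega, ?_⟩
        have h1 := hasPathPart_midSet (s := s) (t := t) hE hn hI hA hp hGE
          fun i hi hi' => hB i (by omega) (hgood i hi hi')
        have h2 := hpart.union h1 midSet_disjoint
        rw [midSet_union (Nat.zero_le _) hs] at h2
        have h3 := h2.union (hasPathPart_midSet_succ (t := t) hE hA hp hGE) midSet_disjoint
        rw [midSet_union (Nat.zero_le _) (Nat.le_succ t)] at h3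
        refine h3.mono ?_
        have hlt : (B.filter (· < s)).card < (B.filter (· < t + 1)).card := by
          refine Finset.card_lt_card (Finset.ssubset_iff_of_subset ?_ |>.2 ⟨t, ?_, ?_⟩)
          · intro i hi
            simp only [Finset.mem_filter] at hi ⊢
            exact ⟨hi.1, by omega⟩
          · simpa using htB
          · simp only [Finset.mem_filter]
            omega
        omega
      · refine ⟨s, by omega, fun i hi hi' => ?_, hpart⟩
        rcases Nat.lt_or_ge i t with h | h
        · exact hgood i hi h
        · rwa [show i = t by omega]
  obtain ⟨s, hs, hgood, hpart⟩ := key L le_rfl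
  have h1 := hasPathPart_midSet (s := s) (t := L) hE hn hI hA hp hGE
    fun i hi hi' => hB i hi' (hgood i hi hi')
  have h2 := hpart.union h1 midSet_disjoint
  rw [midSet_union (Nat.zero_le _) hs] at h2
  have := Finset.card_filter_le B (· < s)
  exact h2.mono (by omega)

/-- The vertices attached to the middle of the path can be partitioned into few paths. -/
theorem hasPathPart_middle (hE : ∀ u v, E u v → ¬ E v u) (hn : 0 < n)
    (hI : Insertable n G E) (hA : ArmFree n G) (hp : IndSeq G p (L + 1))
    (hGE : ∀ u v, G.Adj u v ↔ E u v ∨ E v u) (h3 : CondD3 n E) :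
    HasPathPart E (midSet G p L n 0 L) (2 * (4 * n + 16 + 9 * n * (2 * n + 13)) + 1) := by
  classical
  set T := (Finset.range (L + 1)).filter (TurnAt E G p L n) with hTdef
  have hT : ∀ t, t ∈ T ↔ TurnAt E G p L n t := by
    intro t
    simp only [hTdef, Finset.mem_filter, Finset.mem_range, and_iff_right_iff_imp]
    intro h
    have := h.bounds
    omega
  set B := (Finset.range (2 * n + 6) ∪ Finset.Ico (L - (2 * n + 10)) L) ∪
    T.biUnion (fun t => Finset.Icc (t - (n + 7)) (t + n + 5)) with hBdef
  have hB : B.card ≤ 4 * n + 16 + 9 * n * (2 * n + 13) := by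
    have h1 := Finset.card_union_le (Finset.range (2 * n + 6)) (Finset.Ico (L - (2 * n + 10)) L)
    have h2 := Finset.card_union_le
      (Finset.range (2 * n + 6) ∪ Finset.Ico (L - (2 * n + 10)) L)
      (T.biUnion (fun t => Finset.Icc (t - (n + 7)) (t + n + 5)))
    have h4 := Finset.card_biUnion_le_card_mul T
      (fun t => Finset.Icc (t - (n + 7)) (t + n + 5)) (2 * n + 13)
      (fun t _ => by rw [Nat.card_Icc]; omega)
    have h5 := Nat.mul_le_mul_right (2 * n + 13) (card_turnAt_le hA hp hGE h3 hT)
    rw [Finset.card_range, Nat.card_Ico] at h1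
    rw [hBdef]
    omega
  refine (hasPathPart_midSet_of_bad hE hn hI hA hp hGE (B := B) ?_).mono (by omega)
  intro i hi hiB
  simp only [hBdef, Finset.mem_union, Finset.mem_range, Finset.mem_Ico, Finset.mem_biUnion,
    Finset.mem_Icc, not_or, not_exists, not_and] at hiB
  obtain ⟨⟨h1, h2⟩, h4⟩ := hiB
  refine ⟨by omega, by omega, fun k hk hk' hkT => ?_⟩
  exact h4 k ((hT k).2 hkT) (by omega) (by omega)

end Middle

/-! ## Assembling the partition -/

theorem IndSeq.le_card {V : Type} [Fintype V] {G : SimpleGraph V} {q : ℕ → V} {m : ℕ}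
    (hq : IndSeq G q m) : m ≤ Fintype.card V := by
  have : Function.Injective (fun i : Fin m => q i) := fun i j hij => by
    by_contra hne
    exact hq.ne i.2 j.2 (fun h => hne (Fin.ext h)) hij
  simpa using Fintype.card_le_of_injective _ this

theorem exists_longest_indSeq {V : Type} [Fintype V] (G : SimpleGraph V) (v : V) :
    ∃ (p : ℕ → V) (L : ℕ), IndSeq G p (L + 1) ∧ ∀ q m, IndSeq G q m → m ≤ L + 1 := by
  classical
  have h1 : ∃ q, IndSeq G q 1 := ⟨fun _ => v, fun i j hij hj => by omega⟩
  have hcard : 1 ≤ Fintype.card V := Fintype.card_pos_iff.2 ⟨v⟩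
  have hspec := Nat.findGreatest_spec (P := fun m => ∃ q, IndSeq G q m) hcard h1
  have hge := Nat.le_findGreatest (P := fun m => ∃ q, IndSeq G q m) hcard h1
  obtain ⟨p, hp⟩ := hspec
  refine ⟨p, Nat.findGreatest (fun m => ∃ q, IndSeq G q m) (Fintype.card V) - 1, ?_, ?_⟩
  · rwa [Nat.sub_add_cancel hge]
  · intro q m hq
    rw [Nat.sub_add_cancel hge]
    exact Nat.le_findGreatest hq.le_card ⟨q, hq⟩

section Assembly

variable {V : Type} [DecidableEq V] {E : V → V → Prop} {G : SimpleGraph V} {n L : ℕ}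

theorem IndepLE.hasPathPart {X : Finset V} {k : ℕ} (h : IndepLE G X k)
    (hE : ∀ u v, E u v → ¬ E v u) (hGE : ∀ u v, G.Adj u v ↔ E u v ∨ E v u) :
    HasPathPart E X k :=
  HasPathPart.of_indep (fun u h => hE u u h h) fun I hI hind => h I hI fun u hu v hv huv => by
    rcases (hGE u v).1 huv with h | h
    · exact hind u hu v hv h
    · exact hind v hv u hu h

variable [Fintype V]

/-- In a graph without long induced paths the distance layers partition the vertices. -/
theorem univ_eq_biUnion_layers (hG : G.Connected) {X : Finset V} (hX : X.Nonempty)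
    (hlong : ∀ q m, IndSeq G q m → m ≤ L + 1) {N : ℕ} (hN : L ≤ N) :
    (Finset.range (N + 1)).biUnion (layerFinset G X) = Finset.univ := by
  refine Finset.eq_univ_of_forall fun v => ?_
  obtain ⟨k, hk⟩ := exists_layer_of_connected hG hX v
  obtain ⟨w, rfl, hlay, hadj⟩ := exists_descent k hk
  have hw : IndSeq G w (k + 1) := by
    intro i j hij hj
    refine ⟨ne_of_layer (by omega) (hlay i (by omega)) (hlay j (by omega)), fun h => ?_, ?_⟩
    · by_contra hne
      exact not_adj_of_layer (by omega) (hlay i (by omega)) (hlay j (by omega)) h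
    · rintro rfl
      exact hadj i (by omega)
  have := hlong w _ hw
  exact Finset.mem_biUnion.2 ⟨k, Finset.mem_range.2 (by omega), hk⟩

variable {a : ℕ → ℕ}

theorem IndepLE.layer_add (hn : 2 ≤ n) (hK : ¬ HasInducedCopyG (KStarG n) G)
    (hstar : ¬ HasInducedCopyG (StarG n) G)
    (ha : ∀ i, a (i + 1) = (n - 1) * ramseyNumber n (a i + 1) - 1) {X : Finset V} {j : ℕ}
    (h : IndepLE G (layerFinset G X j) (a 0)) (i : ℕ) :
    IndepLE G (layerFinset G X (j + i)) (a i) := by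
  induction i with
  | zero => exact h
  | succ i ih =>
    rw [ha]
    exact ih.layer_succ hn hK hstar

theorem hasPathPart_of_short (hn : 3 ≤ n) (hE : ∀ u v, E u v → ¬ E v u)
    (hGE : ∀ u v, G.Adj u v ↔ E u v ∨ E v u) (hG : G.Connected)
    (hK : ¬ HasInducedCopyG (KStarG n) G) (hstar : ¬ HasInducedCopyG (StarG n) G)
    (ha0 : n ≤ a 0) (ha : ∀ i, a (i + 1) = (n - 1) * ramseyNumber n (a i + 1) - 1)
    (hlong : ∀ q m, IndSeq G q m → m ≤ L + 1) {N : ℕ} (hN : L ≤ N) :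
    HasPathPart E Finset.univ (1 + ∑ i ∈ Finset.range N, a i) := by
  obtain ⟨v⟩ := hG.nonempty
  have h0 : IndepLE G (layerFinset G {v} 0) 1 := fun I hI _ =>
    (Finset.card_le_card hI).trans (Finset.card_singleton v).le
  have h1 : IndepLE G (layerFinset G {v} 1) (a 0) := by
    intro I hI hind
    refine le_trans (card_lt_of_star_free hstar hind (v := v) fun x hx => ?_).le ha0
    obtain ⟨u, hu, hux⟩ := exists_adj_of_mem_layer (hI hx)
    rwa [Finset.mem_singleton.1 hu] at hux
  have h := HasPathPart.biUnion_range (E := E) (X := layerFinset G {v})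
    (k := fun i => if i = 0 then 1 else a (i - 1)) (N + 1) (fun i _ => ?_)
    (fun i _ j _ hij => layerFinset_disjoint hij)
  · rw [univ_eq_biUnion_layers hG (Finset.singleton_nonempty v) hlong hN,
      Finset.sum_range_succ'] at h
    simpa [add_comm] using h
  · cases i with
    | zero => exact h0.hasPathPart hE hGE
    | succ i =>
      have := (h1.layer_add (by omega) hK hstar ha i).hasPathPart hE hGE
      rw [add_comm 1 i] at this
      simpa using this

theorem hasPathPart_of_long (hn : 3 ≤ n) (hE : ∀ u v, E u v → ¬ E v u)
    (hGE : ∀ u v, G.Adj u v ↔ E u v ∨ E v u) (hG : G.Connected)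
    (hK : ¬ HasInducedCopyG (KStarG n) G) (hstar : ¬ HasInducedCopyG (StarG n) G)
    (hA : ArmFree n G) (hI : Insertable n G E) (h3 : CondD3 n E)
    (ha0 : 2 * (n / 2 + 1) ≤ a 0) (ha : ∀ i, a (i + 1) = (n - 1) * ramseyNumber n (a i + 1) - 1)
    {p : ℕ → V} (hp : IndSeq G p (L + 1)) (hlong : ∀ q m, IndSeq G q m → m ≤ L + 1)
    (hL : 2 * n + 1 ≤ L) (hL' : n * n ≤ L + n + 1) :
    HasPathPart E Finset.univ
      (∑ i ∈ Finset.range (n + 2), a i + (2 * (4 * n + 16 + 9 * n * (2 * n + 13)) + 1)) := by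
  set M := midSet G p L n 0 L with hM
  have hlay : ∀ i, IndepLE G (layerFinset G (endSet p L n) i) (a i) := by
    intro i
    have h0 : IndepLE G (layerFinset G (endSet p L n) 0) (a 0) := (IndepLE.endSet hp).mono ha0
    have := h0.layer_add (by omega) hK hstar ha i
    rwa [Nat.zero_add] at this
  have h := HasPathPart.biUnion_range (E := E) (X := fun i => layerFinset G (endSet p L n) i \ M)
    (k := a) (n + 2) (fun i _ => ((hlay i).subset Finset.sdiff_subset).hasPathPart hE hGE)
    (fun i _ j _ hij => (layerFinset_disjoint hij).mono Finset.sdiff_subset Finset.sdiff_subset)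
  have hmid := hasPathPart_middle hE (by omega) hI hA hp hGE h3
  rw [← hM] at hmid
  have hdisj : Disjoint
      ((Finset.range (n + 2)).biUnion fun i => layerFinset G (endSet p L n) i \ M) M := by
    rw [Finset.disjoint_biUnion_left]
    exact fun i _ => Finset.sdiff_disjoint
  have hu := h.union hmid hdisj
  convert hu using 1
  refine (Finset.eq_univ_of_forall fun v => ?_).symm
  by_cases hv : v ∈ M
  · exact Finset.mem_union_right _ hv
  · refine Finset.mem_union_left _ ?_
    have hball := mem_ball_of_not_span hn hA hstar hG hp hlong hL hL' (v := v) (fun l r h => by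
      have := h.hr
      have := h.hlr
      exact hv (mem_midSet.2 ⟨l, r, h, Nat.zero_le _, by omega⟩))
    rw [ballFinset_eq_biUnion] at hball
    obtain ⟨i, hi, hvi⟩ := Finset.mem_biUnion.1 hball
    exact Finset.mem_biUnion.2 ⟨i, hi, Finset.mem_sdiff.2 ⟨hvi, hv⟩⟩

end Assembly

theorem four_pow_mul_le {n : ℕ} {a : ℕ → ℕ} (hn : 3 ≤ n)
    (ha : ∀ i, a (i + 1) = (n - 1) * ramseyNumber n (a i + 1) - 1) (i : ℕ) :
    4 ^ i * a 0 ≤ a i := by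
  induction i with
  | zero => simp
  | succ i ih =>
    have h1 := two_mul_lt_ramseyNumber hn (a i)
    have h2 : 2 * ramseyNumber n (a i + 1) ≤ (n - 1) * ramseyNumber n (a i + 1) :=
      Nat.mul_le_mul_right _ (by omega)
    have h4 := ha i
    rw [pow_succ', mul_assoc]
    omega

theorem linear_le_four_pow {k : ℕ} (hk : 5 ≤ k) : 18 * k + 272 ≤ 4 ^ k := by
  induction k, hk using Nat.le_induction with
  | base => norm_num
  | succ k hk ih =>
    rw [pow_succ]
    omega

/-- Explicit bound on `pp(D)` for weakly connected digraphs
satisfying (D'1), (D2) and (D3), where `n₀ = max{⌈(n²−n−2)/2⌉, n}`, `α₀ = 2⌈n₀/2⌉`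
and `α_i = (n−1)·R(n, α_{i−1}+1) − 1`. -/
theorem pp_le_explicit_bound (n : ℕ) (hn : 3 ≤ n)
    (n₀ : ℕ) (hn₀ : n₀ = max ((n ^ 2 - n - 1) / 2) n)
    (a : ℕ → ℕ) (ha0 : a 0 = 2 * ((n₀ + 1) / 2))
    (haS : ∀ i : ℕ, a (i + 1) = (n - 1) * ramseyNumber n (a i + 1) - 1)
    (V : Type) [Fintype V] (E : V → V → Prop)
    (hE : ∀ u v : V, E u v → ¬ E v u)
    (hconn : (SimpleGraph.fromRel E).Connected)
    (h1 : CondD1' n E) (h2 : CondD2 n E) (h3 : CondD3 n E) :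
    ppOn E Set.univ ≤ (∑ i ∈ Finset.Icc 1 (2 * n₀ - 1), a i) +
      n * (2 * n - 1) * (n - 1) +
      (n + 1) * (n * (n + 5) / 2 + 1) := by
  classical
  set G := SimpleGraph.fromRel E with hGdef
  have hGE : ∀ u v, G.Adj u v ↔ E u v ∨ E v u := fun u v => fromRel_adj_iff hE
  obtain ⟨⟨hK, hstar, hF1, hF2⟩, hF3, hF4⟩ := h1
  have hA : ArmFree n G := ⟨hF1, hF2, hF3, hF4⟩
  have hI : Insertable n G E := fun y z x hy hz hyz hxy hxz dy dyz dz =>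
    h2.insert_middle (by omega) hE hy hz hyz hxy hxz dy dyz dz
  obtain ⟨v⟩ := hconn.nonempty
  obtain ⟨p, L, hp, hlong⟩ := exists_longest_indSeq G v
  have hsq : n ^ 2 = n * n := sq n
  have hnn : 3 * n ≤ n * n := Nat.mul_le_mul_right n hn
  have hn0 : n ≤ n₀ := hn₀ ▸ le_max_right _ _
  have hn0' : (n ^ 2 - n - 1) / 2 ≤ n₀ := hn₀ ▸ le_max_left _ _
  have hn0'' : n₀ ≤ n * n := by
    rw [hn₀]
    exact max_le (by omega) (by omega)
  have hextra : n * n + 2 ≤ (n + 1) * (n * (n + 5) / 2 + 1) := by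
    have h4 : n ≤ n * (n + 5) / 2 := by
      rw [Nat.le_div_iff_mul_le (by norm_num)]
      exact Nat.mul_le_mul_left n (by omega)
    calc n * n + 2 ≤ (n + 1) * (n + 1) := by ring_nf; omega
      _ ≤ _ := Nat.mul_le_mul_left _ (by omega)
  have hsum : ∑ i ∈ Finset.range (2 * n₀), a i =
      a 0 + ∑ i ∈ Finset.Icc 1 (2 * n₀ - 1), a i := by
    rw [Finset.range_eq_Ico, Finset.sum_eq_sum_Ico_succ_bot (by omega)]
    congr 2
  rcases Nat.lt_or_ge (2 * n₀) L with hL | hL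
  · have ha0' : 2 * (n / 2 + 1) ≤ a 0 := by
      rcases Nat.lt_or_ge n 5 with h5 | h5
      · interval_cases n <;> simp at hn₀ <;> omega
      · have : 5 * n ≤ n * n := Nat.mul_le_mul_right n h5
        omega
    have hmain := (hasPathPart_of_long hn hE hGE hconn hK hstar hA hI h3 ha0' haS hp hlong
      (by omega) (by omega)).ppOn_le
    have hsub : ∑ i ∈ Finset.range (n + 2), a i ≤ ∑ i ∈ Finset.range (2 * n₀ - 1), a i :=
      Finset.sum_le_sum_of_subset (Finset.range_subset_range.2 (by omega))
    have hlast : ∑ i ∈ Finset.range (2 * n₀), a i =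
        ∑ i ∈ Finset.range (2 * n₀ - 1), a i + a (2 * n₀ - 1) := by
      conv_lhs => rw [show 2 * n₀ = 2 * n₀ - 1 + 1 by omega]
      rw [Finset.sum_range_succ]
    have hpow := four_pow_mul_le hn haS (2 * n₀ - 1)
    have hlin := Nat.mul_le_mul_right (a 0) (linear_le_four_pow (k := 2 * n₀ - 1) (by omega))
    have hbig : a 0 + (2 * (4 * n + 16 + 9 * n * (2 * n + 13)) + 1) ≤
        (18 * (2 * n₀ - 1) + 272) * a 0 := by
      obtain ⟨b, hb⟩ : ∃ b, a 0 = n + b := ⟨a 0 - n, by omega⟩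
      have h5 : 36 * n + 254 ≤ 18 * (2 * n₀ - 1) + 272 := by omega
      refine le_trans ?_ (Nat.mul_le_mul_right _ h5)
      rw [hb]
      nlinarith
    omega
  · have hmain := (hasPathPart_of_short hn hE hGE hconn hK hstar (by omega) haS hlong hL).ppOn_le
    have : a 0 ≤ n * n + 1 := by omega
    omega
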